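/- arXiv:2512.02145 — 3 statements merged into one kernel-verified Lean document; each statement's English description precedes it below -/
import Mathlib

section
/- Assume Assumption A2. Let N ≥ 1 be an integer and u ∈ H^{2N}_κ(Ω). Then there exists a unique coefficient vector β = (β_{p,m})_{p∈N_h, 1≤m≤N} ∈ ℂ^{N·|N_h|} satisfying the collocation system Σ_{p∈N_h} Σ_{m=1}^{N} β_{p,m}·(κ^{−1}∂₁)^{2n}ψ_{p,m}(q) = (κ^{−1}∂₁)^{2n}u(q) for all 0 ≤ n ≤ N−1 and all nodes q ∈ N_h. Moreover ‖β‖_∞ ≤ (2ρ·max(1,κh)²/h)·χ_N·‖u‖_{H^{2N}_κ(Ω)}, where χ_N := min( ρe^{κh}/(κh), e·max(1,κh)^{2(N−1)} ). -/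
open MeasureTheory Real Set
open scoped Real Classical ENNReal NNReal

noncomputable section

/-- Partial derivative in the first coordinate. -/
def pd1 (f : ℝ × ℝ → ℂ) : ℝ × ℝ → ℂ := fun x => deriv (fun t => f (t, x.2)) x.1

/-- Partial derivative in the second coordinate. -/
def pd2 (f : ℝ × ℝ → ℂ) : ℝ × ℝ → ℂ := fun x => deriv (fun t => f (x.1, t)) x.2

/-- Mixed partial derivative `∂₁^i ∂₂^j`. -/
def pdM (i j : ℕ) (f : ℝ × ℝ → ℂ) : ℝ × ℝ → ℂ := pd1^[i] (pd2^[j] f)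

/-- Multi-indices of order at most `M`. -/
def idxLe (M : ℕ) : Finset (ℕ × ℕ) :=
  (Finset.range (M + 1) ×ˢ Finset.range (M + 1)).filter fun p => p.1 + p.2 ≤ M

/-- κ-weighted Sobolev inner product of order `M` on `D`. -/
def sobInner (κ : ℝ) (M : ℕ) (D : Set (ℝ × ℝ)) (f g : ℝ × ℝ → ℂ) : ℂ :=
  ∑ p ∈ idxLe M, ((κ : ℂ) ^ (2 * (p.1 + p.2)))⁻¹ *
    ∫ x in D, pdM p.1 p.2 f x * (starRingEnd ℂ) (pdM p.1 p.2 g x)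

/-- Square of the κ-weighted Sobolev norm of order `M` on `D`. -/
def sobNormSq (κ : ℝ) (M : ℕ) (D : Set (ℝ × ℝ)) (f : ℝ × ℝ → ℂ) : ℝ :=
  ∑ p ∈ idxLe M, (κ ^ (2 * (p.1 + p.2)))⁻¹ * ∫ x in D, ‖pdM p.1 p.2 f x‖ ^ 2

/-- κ-weighted Sobolev norm of order `M` on `D`. -/
def sobNorm (κ : ℝ) (M : ℕ) (D : Set (ℝ × ℝ)) (f : ℝ × ℝ → ℂ) : ℝ :=
  Real.sqrt (sobNormSq κ M D f)

/-- Membership in `H^M_κ(D)` (for pointwise-differentiable representatives). -/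
def MemSob (M : ℕ) (D : Set (ℝ × ℝ)) (f : ℝ × ℝ → ℂ) : Prop :=
  ∀ p ∈ idxLe M, IntegrableOn (fun x => ‖pdM p.1 p.2 f x‖ ^ 2) D

/-- `ν̂_n = nπ/(κ ĥ₁)`. -/
def nuHat (κ h1 : ℝ) (n : ℕ) : ℝ := n * π / (κ * h1)

/-- Principal complex square root of a real number. -/
def csqrt (r : ℝ) : ℂ := (r : ℂ) ^ (1 / 2 : ℂ)

/-- The single-edge Helmholtz mode `φ̂_n` on the reference rectangle. -/
def phiHat (κ h1 h2 : ℝ) (n : ℕ) : ℝ × ℝ → ℂ := fun x =>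
  Complex.sin (↑(κ * nuHat κ h1 n) * (x.1 : ℂ)) *
    Complex.sin ((x.2 : ℂ) * (κ : ℂ) * csqrt (1 - nuHat κ h1 n ^ 2)) /
    Complex.sin ((h2 : ℂ) * (κ : ℂ) * csqrt (1 - nuHat κ h1 n ^ 2))

/-- The open reference rectangle `K̂ = (0,ĥ₁) × (0,ĥ₂)`. -/
def Khat (h1 h2 : ℝ) : Set (ℝ × ℝ) := Ioo 0 h1 ×ˢ Ioo 0 h2

/-- Assumption A0: `κ²` is not a Δ-Neumann eigenvalue of the rectangle with sides `h1, h2`. -/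
def A0cond (κ h1 h2 : ℝ) : Prop :=
  ∀ n m : ℕ, κ ^ 2 ≠ (n * π / h1) ^ 2 + (m * π / h2) ^ 2

/-- Distributional (weak) solution of the homogeneous Helmholtz equation on `D`. -/
def WeakHelmholtz (κ : ℝ) (D : Set (ℝ × ℝ)) (u : ℝ × ℝ → ℂ) : Prop :=
  IntegrableOn u D ∧
  ∀ φ : ℝ × ℝ → ℂ, ContDiff ℝ (⊤ : ℕ∞) φ → HasCompactSupport φ → tsupport φ ⊆ D →
    ∫ x in D, u x * (pdM 2 0 φ x + pdM 0 2 φ x + (κ : ℂ) ^ 2 * φ x) = 0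

/-- The trace of `u` on the top edge (at height `h2`). -/
def traceTop (h2 : ℝ) (u : ℝ × ℝ → ℂ) : ℝ → ℂ := fun t => u (t, h2)

/-- The class `S^{N,M}_κ(K̂, ŝ)` of Helmholtz solutions with trace supported on the top edge. -/
structure SLoc (κ h1 h2 : ℝ) (N M : ℕ) (u : ℝ × ℝ → ℂ) : Prop where
  cont : ContinuousOn u (Icc 0 h1 ×ˢ Icc 0 h2)
  mem : MemSob 1 (Khat h1 h2) u
  helm : WeakHelmholtz κ (Khat h1 h2) u
  left : ∀ y ∈ Icc (0 : ℝ) h2, u (0, y) = 0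
  right : ∀ y ∈ Icc (0 : ℝ) h2, u (h1, y) = 0
  bottom : ∀ x ∈ Icc (0 : ℝ) h1, u (x, 0) = 0
  traceReg : ContDiffOn ℝ M (traceTop h2 u) (Icc 0 h1)
  endpt0 : ∀ j < N, iteratedDerivWithin (2 * j) (traceTop h2 u) (Icc 0 h1) 0 = 0
  endpt1 : ∀ j < N, iteratedDerivWithin (2 * j) (traceTop h2 u) (Icc 0 h1) h1 = 0

/-- Square of the trace seminorm `|u|_{H^M_κ(ŝ)}`. -/
def traceSemiSq (κ h1 h2 : ℝ) (M : ℕ) (u : ℝ × ℝ → ℂ) : ℝ :=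
  (κ ^ (2 * M))⁻¹ * ∫ t in (0 : ℝ)..h1, ‖iteratedDerivWithin M (traceTop h2 u) (Icc 0 h1) t‖ ^ 2

/-- The `L²(ŝ)` inner product of traces on the top edge. -/
def traceL2Inner (h1 h2 : ℝ) (u v : ℝ × ℝ → ℂ) : ℂ :=
  ∫ t in (0 : ℝ)..h1, u (t, h2) * (starRingEnd ℂ) (v (t, h2))

/-- The squared `L²(ŝ)` norm of the trace on the top edge. -/
def traceL2Sq (h1 h2 : ℝ) (u : ℝ × ℝ → ℂ) : ℝ :=
  ∫ t in (0 : ℝ)..h1, ‖u (t, h2)‖ ^ 2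


/-! ### Cartesian mesh machinery -/

/-- The open cell of the Cartesian grid indexed by `c ∈ ℤ²`. -/
def cellO (h1 h2 : ℝ) (c : ℤ × ℤ) : Set (ℝ × ℝ) :=
  Ioo ((c.1 : ℝ) * h1) (((c.1 : ℝ) + 1) * h1) ×ˢ Ioo ((c.2 : ℝ) * h2) (((c.2 : ℝ) + 1) * h2)

/-- The closed cell of the Cartesian grid indexed by `c ∈ ℤ²`. -/
def cellC (h1 h2 : ℝ) (c : ℤ × ℤ) : Set (ℝ × ℝ) :=
  Icc ((c.1 : ℝ) * h1) (((c.1 : ℝ) + 1) * h1) ×ˢ Icc ((c.2 : ℝ) * h2) (((c.2 : ℝ) + 1) * h2)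

/-- Horizontal edges of the mesh: `(i,j)` corresponds to `[i h₁,(i+1)h₁] × {j h₂}`. -/
def hEdges (cells : Finset (ℤ × ℤ)) : Finset (ℤ × ℤ) :=
  cells ∪ cells.image fun c => (c.1, c.2 + 1)

/-- Vertical edges of the mesh: `(i,j)` corresponds to `{i h₁} × [j h₂,(j+1)h₂]`. -/
def vEdges (cells : Finset (ℤ × ℤ)) : Finset (ℤ × ℤ) :=
  cells ∪ cells.image fun c => (c.1 + 1, c.2)

/-- Nodes of the mesh: `(i,j)` corresponds to the point `(i h₁, j h₂)`. -/
def meshNodes (cells : Finset (ℤ × ℤ)) : Finset (ℤ × ℤ) :=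
  ((cells ∪ cells.image fun c => (c.1 + 1, c.2)) ∪
    cells.image fun c => (c.1, c.2 + 1)) ∪
    cells.image fun c => (c.1 + 1, c.2 + 1)

/-- The point of `ℝ²` corresponding to the node index `p`. -/
def nodePt (h1 h2 : ℝ) (p : ℤ × ℤ) : ℝ × ℝ := ((p.1 : ℝ) * h1, (p.2 : ℝ) * h2)

/-- `Ω` is exactly tessellated by the cells of the Cartesian grid indexed by `cells`. -/
def IsTessellation (h1 h2 : ℝ) (cells : Finset (ℤ × ℤ)) (Ω : Set (ℝ × ℝ)) : Prop :=
  cells.Nonempty ∧ Ω = interior (⋃ c ∈ cells, cellC h1 h2 c) ∧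
    closure Ω = ⋃ c ∈ cells, cellC h1 h2 c

/-- The edge basis function `φ_{s,n}` associated with the horizontal edge `e`. -/
def phiEdgeH (κ h1 h2 : ℝ) (cells : Finset (ℤ × ℤ)) (e : ℤ × ℤ) (n : ℕ) : ℝ × ℝ → ℂ :=
  fun x =>
    if e ∈ cells ∧ x ∈ cellC h1 h2 e then
      phiHat κ h1 h2 n (x.1 - (e.1 : ℝ) * h1, h2 + ((e.2 : ℝ) * h2 - x.2))
    else if (e.1, e.2 - 1) ∈ cells ∧ x ∈ cellC h1 h2 (e.1, e.2 - 1) then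
      phiHat κ h1 h2 n (x.1 - (e.1 : ℝ) * h1, h2 - ((e.2 : ℝ) * h2 - x.2))
    else 0

/-- The edge basis function `φ_{s,n}` associated with the vertical edge `e`. -/
def phiEdgeV (κ h1 h2 : ℝ) (cells : Finset (ℤ × ℤ)) (e : ℤ × ℤ) (n : ℕ) : ℝ × ℝ → ℂ :=
  fun x =>
    if e ∈ cells ∧ x ∈ cellC h1 h2 e then
      phiHat κ h2 h1 n (x.2 - (e.2 : ℝ) * h2, h1 + ((e.1 : ℝ) * h1 - x.1))
    else if (e.1 - 1, e.2) ∈ cells ∧ x ∈ cellC h1 h2 (e.1 - 1, e.2) then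
      phiHat κ h2 h1 n (x.2 - (e.2 : ℝ) * h2, h1 - ((e.1 : ℝ) * h1 - x.1))
    else 0

/-- The node basis function `ψ_{p,n}` associated with the node `p`. -/
def psiNode (κ h1 h2 : ℝ) (p : ℤ × ℤ) (n : ℕ) : ℝ × ℝ → ℂ :=
  fun x =>
    if x ∈ Icc (((p.1 : ℝ) - 1) * h1) (((p.1 : ℝ) + 1) * h1) ×ˢ
        Icc ((p.2 : ℝ) * h2) (((p.2 : ℝ) + 1) * h2) then
      phiHat κ (2 * h1) h2 (2 * n - 1) (h1 - ((p.1 : ℝ) * h1 - x.1), h2 + ((p.2 : ℝ) * h2 - x.2))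
    else if x ∈ Icc (((p.1 : ℝ) - 1) * h1) (((p.1 : ℝ) + 1) * h1) ×ˢ
        Icc (((p.2 : ℝ) - 1) * h2) ((p.2 : ℝ) * h2) then
      phiHat κ (2 * h1) h2 (2 * n - 1) (h1 - ((p.1 : ℝ) * h1 - x.1), h2 - ((p.2 : ℝ) * h2 - x.2))
    else 0

/-- The set of edge basis functions with at most `Ne` modes per edge. -/
def edgeFuns (κ h1 h2 : ℝ) (cells : Finset (ℤ × ℤ)) (Ne : ℕ) : Set (ℝ × ℝ → ℂ) :=
  {f | ∃ e ∈ hEdges cells, ∃ n : ℕ, 1 ≤ n ∧ n ≤ Ne ∧ f = phiEdgeH κ h1 h2 cells e n} ∪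
  {f | ∃ e ∈ vEdges cells, ∃ n : ℕ, 1 ≤ n ∧ n ≤ Ne ∧ f = phiEdgeV κ h1 h2 cells e n}

/-- The set of node basis functions with at most `Nn` modes per node. -/
def nodeFuns (κ h1 h2 : ℝ) (cells : Finset (ℤ × ℤ)) (Nn : ℕ) : Set (ℝ × ℝ → ℂ) :=
  {f | ∃ p ∈ meshNodes cells, ∃ n : ℕ, 1 ≤ n ∧ n ≤ Nn ∧ f = psiNode κ h1 h2 p n}

/-- The edge-based Trefftz space `V_{N_e}(Σ_h)`. -/
def edgeSpace (κ h1 h2 : ℝ) (cells : Finset (ℤ × ℤ)) (Ne : ℕ) :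
    Submodule ℂ (ℝ × ℝ → ℂ) :=
  Submodule.span ℂ (edgeFuns κ h1 h2 cells Ne)

/-- The combined edge-and-node Trefftz space `V_𝐍(T_h)`. -/
def combinedSpace (κ h1 h2 : ℝ) (cells : Finset (ℤ × ℤ)) (Ne Nn : ℕ) :
    Submodule ℂ (ℝ × ℝ → ℂ) :=
  Submodule.span ℂ (edgeFuns κ h1 h2 cells Ne ∪ nodeFuns κ h1 h2 cells Nn)

/-- Square of the broken Sobolev norm `‖·‖²_{H^r_κ(T_h)}`. -/
def brokenNormSq (κ : ℝ) (r : ℕ) (h1 h2 : ℝ) (cells : Finset (ℤ × ℤ))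
    (f : ℝ × ℝ → ℂ) : ℝ :=
  ∑ c ∈ cells, sobNormSq κ r (cellO h1 h2 c) f

/-- The global class `S^{N,M}_κ(T_h)`. -/
structure SGlob (κ h1 h2 : ℝ) (cells : Finset (ℤ × ℤ)) (Ω : Set (ℝ × ℝ)) (N M : ℕ)
    (u : ℝ × ℝ → ℂ) : Prop where
  cont : ContinuousOn u (closure Ω)
  mem : ∀ c ∈ cells, MemSob 1 (cellO h1 h2 c) u
  helm : ∀ c ∈ cells, WeakHelmholtz κ (cellO h1 h2 c) u
  htraceReg : ∀ e ∈ hEdges cells,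
    ContDiffOn ℝ M (fun t => u (t, (e.2 : ℝ) * h2)) (Icc ((e.1 : ℝ) * h1) (((e.1 : ℝ) + 1) * h1))
  hend : ∀ e ∈ hEdges cells, ∀ j < N,
    iteratedDerivWithin (2 * j) (fun t => u (t, (e.2 : ℝ) * h2))
        (Icc ((e.1 : ℝ) * h1) (((e.1 : ℝ) + 1) * h1)) ((e.1 : ℝ) * h1) = 0 ∧
    iteratedDerivWithin (2 * j) (fun t => u (t, (e.2 : ℝ) * h2))
        (Icc ((e.1 : ℝ) * h1) (((e.1 : ℝ) + 1) * h1)) (((e.1 : ℝ) + 1) * h1) = 0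
  vtraceReg : ∀ e ∈ vEdges cells,
    ContDiffOn ℝ M (fun t => u ((e.1 : ℝ) * h1, t)) (Icc ((e.2 : ℝ) * h2) (((e.2 : ℝ) + 1) * h2))
  vend : ∀ e ∈ vEdges cells, ∀ j < N,
    iteratedDerivWithin (2 * j) (fun t => u ((e.1 : ℝ) * h1, t))
        (Icc ((e.2 : ℝ) * h2) (((e.2 : ℝ) + 1) * h2)) ((e.2 : ℝ) * h2) = 0 ∧
    iteratedDerivWithin (2 * j) (fun t => u ((e.1 : ℝ) * h1, t))
        (Icc ((e.2 : ℝ) * h2) (((e.2 : ℝ) + 1) * h2)) (((e.2 : ℝ) + 1) * h2) = 0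

/-- Square of the skeleton seminorm `|u|²_{H^μ_κ(Σ_h)}`. -/
def skelSemiSq (κ h1 h2 : ℝ) (cells : Finset (ℤ × ℤ)) (μ : ℕ) (u : ℝ × ℝ → ℂ) : ℝ :=
  (∑ e ∈ hEdges cells, (κ ^ (2 * μ))⁻¹ *
    ∫ t in ((e.1 : ℝ) * h1)..(((e.1 : ℝ) + 1) * h1),
      ‖iteratedDerivWithin μ (fun t => u (t, (e.2 : ℝ) * h2))
          (Icc ((e.1 : ℝ) * h1) (((e.1 : ℝ) + 1) * h1)) t‖ ^ 2) +
  ∑ e ∈ vEdges cells, (κ ^ (2 * μ))⁻¹ *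
    ∫ t in ((e.2 : ℝ) * h2)..(((e.2 : ℝ) + 1) * h2),
      ‖iteratedDerivWithin μ (fun t => u ((e.1 : ℝ) * h1, t))
          (Icc ((e.2 : ℝ) * h2) (((e.2 : ℝ) + 1) * h2)) t‖ ^ 2

/-- `ν̃_n = (2n−1)π/(2κh₁)`. -/
def nuTil (κ h1 : ℝ) (n : ℕ) : ℝ := (2 * (n : ℝ) - 1) * π / (2 * (κ * h1))

/-- `d̃`: distance to the node-associated propagative resonances. -/
def dTil (κ h1 h2 : ℝ) : ℝ :=
  sInf {d : ℝ | ∃ n : ℕ, 1 ≤ n ∧ nuTil κ h1 n < 1 ∧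
    ∃ m : ℕ, d = |Real.sqrt (1 - nuTil κ h1 n ^ 2) - m * π / (κ * h2)|}

/-- `d̃₀`. -/
def dTil0 (κ h1 : ℝ) : ℝ :=
  sInf {d : ℝ | ∃ n : ℕ, 1 ≤ n ∧ 1 < nuTil κ h1 n ∧ d = Real.sqrt (nuTil κ h1 n ^ 2 - 1)}

/-- `χ_N = min(ρe^{κh}/(κh), e·max(1,κh)^{2(N−1)})`. -/
def chiN (ρ kh : ℝ) (N : ℕ) : ℝ :=
  min (ρ * Real.exp kh / kh) (Real.exp 1 * max 1 kh ^ (2 * (N - 1)))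


/-- Assumption A2: `κ² ∉ σ(2h₁,h₂)`. -/
def A2cond (κ h1 h2 : ℝ) : Prop := A0cond κ (2 * h1) h2

/-- The nodal collocation system for coefficients `β` and datum `u`. -/
def CollocationSystem (κ h1 h2 : ℝ) (cells : Finset (ℤ × ℤ)) (N : ℕ)
    (u : ℝ × ℝ → ℂ) (β : {p : ℤ × ℤ // p ∈ meshNodes cells} × Fin N → ℂ) : Prop :=
  ∀ n : ℕ, n ≤ N - 1 → ∀ q ∈ meshNodes cells,
    (∑ p ∈ (meshNodes cells).attach, ∑ m : Fin N,
        β (p, m) * (((κ : ℂ)⁻¹) ^ (2 * n) *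
          pdM (2 * n) 0 (psiNode κ h1 h2 p.1 ((m : ℕ) + 1)) (nodePt h1 h2 q))) =
      ((κ : ℂ)⁻¹) ^ (2 * n) * pdM (2 * n) 0 u (nodePt h1 h2 q)

/-! ### Iterated partial derivatives along a line -/

lemma pd1_iterate_apply (k : ℕ) (f : ℝ × ℝ → ℂ) (x y : ℝ) :
    pd1^[k] f (x, y) = deriv^[k] (fun t => f (t, y)) x := by
  induction k generalizing f with
  | zero => rfl
  | succ k ih => rw [Function.iterate_succ_apply, Function.iterate_succ_apply, ih]; rfl

/-- At the right end of an interval on which a function vanishes, its derivative is zero: if the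
two-sided derivative exists it equals the left one, and otherwise it is zero by convention. -/
lemma deriv_eq_zero_of_eqOn_Iic {g : ℝ → ℂ} {a : ℝ} (h : ∀ t ≤ a, g t = 0) :
    ∀ t ≤ a, deriv g t = 0 := by
  intro t ht
  by_cases hd : DifferentiableAt ℝ g t
  · have h1 : HasDerivWithinAt g (deriv g t) (Iic t) t := hd.hasDerivAt.hasDerivWithinAt
    have h2 : HasDerivWithinAt g 0 (Iic t) t :=
      (hasDerivWithinAt_const t (Iic t) (0 : ℂ)).congr (fun s hs => h s (le_trans hs ht)) (h t ht)
    exact (uniqueDiffWithinAt_Iic t).eq_deriv _ h1 h2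
  · exact deriv_zero_of_not_differentiableAt hd

lemma deriv_eq_zero_of_eqOn_Ici {g : ℝ → ℂ} {a : ℝ} (h : ∀ t ≥ a, g t = 0) :
    ∀ t ≥ a, deriv g t = 0 := by
  intro t ht
  by_cases hd : DifferentiableAt ℝ g t
  · have h1 : HasDerivWithinAt g (deriv g t) (Ici t) t := hd.hasDerivAt.hasDerivWithinAt
    have h2 : HasDerivWithinAt g 0 (Ici t) t :=
      (hasDerivWithinAt_const t (Ici t) (0 : ℂ)).congr (fun s hs => h s (le_trans ht hs)) (h t ht)
    exact (uniqueDiffWithinAt_Ici t).eq_deriv _ h1 h2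
  · exact deriv_zero_of_not_differentiableAt hd

lemma iterate_deriv_eq_zero_of_eqOn_Iic {g : ℝ → ℂ} {a : ℝ} (k : ℕ) (h : ∀ t ≤ a, g t = 0) :
    ∀ t ≤ a, deriv^[k] g t = 0 := by
  induction k generalizing g with
  | zero => exact h
  | succ k ih => exact ih (deriv_eq_zero_of_eqOn_Iic h)

lemma iterate_deriv_eq_zero_of_eqOn_Ici {g : ℝ → ℂ} {a : ℝ} (k : ℕ) (h : ∀ t ≥ a, g t = 0) :
    ∀ t ≥ a, deriv^[k] g t = 0 := by
  induction k generalizing g with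
  | zero => exact h
  | succ k ih => exact ih (deriv_eq_zero_of_eqOn_Ici h)

lemma iterate_deriv_eventuallyEq {f g : ℝ → ℂ} {a : ℝ} (k : ℕ)
    (h : f =ᶠ[nhds a] g) : deriv^[k] f =ᶠ[nhds a] deriv^[k] g := by
  induction k generalizing f g with
  | zero => exact h
  | succ k ih => exact ih h.deriv

lemma deriv_deriv_sin_affine (A : ℂ) (c d : ℝ) :
    deriv (deriv fun t : ℝ => A * Complex.sin (c * ((t + d : ℝ) : ℂ))) =
      fun t : ℝ => (A * (-(c : ℂ) ^ 2)) * Complex.sin (c * ((t + d : ℝ) : ℂ)) := by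
  have hlin : ∀ t : ℝ, HasDerivAt (fun t : ℝ => (c : ℂ) * ((t + d : ℝ) : ℂ)) (c : ℂ) t := by
    intro t
    have := (((hasDerivAt_id t).add_const d).ofReal_comp).const_mul (c : ℂ)
    simpa using this
  have h1 : deriv (fun t : ℝ => A * Complex.sin (c * ((t + d : ℝ) : ℂ))) =
      fun t : ℝ => A * (Complex.cos (c * ((t + d : ℝ) : ℂ)) * c) := by
    funext t
    exact (((Complex.hasDerivAt_sin _).comp t (hlin t)).const_mul A).deriv
  rw [h1]
  funext t
  refine (((((Complex.hasDerivAt_cos _).comp t (hlin t)).mul_const (c : ℂ)).const_mul A).deriv).trans ?_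
  ring

lemma iterate_deriv_sin_affine (n : ℕ) (A : ℂ) (c d : ℝ) :
    deriv^[2 * n] (fun t : ℝ => A * Complex.sin (c * ((t + d : ℝ) : ℂ))) =
      fun t : ℝ => (A * (-(c : ℂ) ^ 2) ^ n) * Complex.sin (c * ((t + d : ℝ) : ℂ)) := by
  induction n generalizing A with
  | zero => simp
  | succ n ih =>
    rw [show 2 * (n + 1) = 2 * n + 1 + 1 by ring, Function.iterate_succ_apply,
      Function.iterate_succ_apply, deriv_deriv_sin_affine, ih]
    funext t
    ring

/-! ### Values of the node basis functions -/

lemma csqrt_sq (r : ℝ) : csqrt r ^ 2 = r := by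
  unfold csqrt
  rw [one_div, ← Nat.cast_two, Complex.cpow_nat_inv_pow _ two_ne_zero]

lemma sin_csqrt_ne_zero {κ h1 h2 : ℝ} (hκ : 0 < κ) (hh2 : 0 < h2)
    (hA : A0cond κ h1 h2) (n : ℕ) :
    Complex.sin ((h2 : ℂ) * (κ : ℂ) * csqrt (1 - nuHat κ h1 n ^ 2)) ≠ 0 := by
  intro h0
  obtain ⟨k, hk⟩ := Complex.sin_eq_zero_iff.mp h0
  have h3 := congrArg (· ^ 2) hk
  simp only [mul_pow, csqrt_sq] at h3
  have h4 : h2 ^ 2 * κ ^ 2 * (1 - nuHat κ h1 n ^ 2) = (k : ℝ) ^ 2 * π ^ 2 := by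
    exact_mod_cast h3
  apply hA n k.natAbs
  have h5 : ((k.natAbs : ℝ)) ^ 2 = (k : ℝ) ^ 2 := by
    rw [Nat.cast_natAbs, Int.cast_abs, sq_abs]
  have h6 : κ * nuHat κ h1 n = n * π / h1 := by
    unfold nuHat
    rw [mul_div_assoc', mul_div_mul_left _ _ hκ.ne']
  rw [← h6, div_pow, mul_pow (k.natAbs : ℝ), h5, ← h4]
  field_simp
  ring

lemma mul_nuHat_odd {κ h1 : ℝ} (hκ : 0 < κ) (m : ℕ) :
    κ * nuHat κ (2 * h1) (2 * (m + 1) - 1) = (2 * m + 1) * π / (2 * h1) := by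
  unfold nuHat
  rw [mul_div_assoc', mul_div_mul_left _ _ hκ.ne', show 2 * (m + 1) - 1 = 2 * m + 1 by omega]
  push_cast
  ring

lemma psiNode_eq_zero_of_row_ne {κ h1 h2 : ℝ} (hh2 : 0 < h2) {p q : ℤ × ℤ}
    (hpq : q.2 ≠ p.2) (n : ℕ) (t : ℝ) : psiNode κ h1 h2 p n (t, (q.2 : ℝ) * h2) = 0 := by
  unfold psiNode
  split_ifs with h h'
  · have ha : p.2 ≤ q.2 := by exact_mod_cast le_of_mul_le_mul_right h.2.1 hh2
    have hb : q.2 ≤ p.2 + 1 := by exact_mod_cast le_of_mul_le_mul_right h.2.2 hh2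
    have hc : q.2 = p.2 + 1 := by omega
    have hz : h2 + ((p.2 : ℝ) * h2 - (q.2 : ℝ) * h2) = 0 := by rw [hc]; push_cast; ring
    simp [phiHat, hz]
  · have ha : p.2 - 1 ≤ q.2 := by exact_mod_cast le_of_mul_le_mul_right h'.2.1 hh2
    have hb : q.2 ≤ p.2 := by exact_mod_cast le_of_mul_le_mul_right h'.2.2 hh2
    have hc : q.2 = p.2 - 1 := by omega
    have hz : h2 - ((p.2 : ℝ) * h2 - (q.2 : ℝ) * h2) = 0 := by rw [hc]; push_cast; ring
    simp [phiHat, hz]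
  · rfl

lemma psiNode_row {κ h1 h2 : ℝ} (hκ : 0 < κ) (hh2 : 0 < h2) (hA2 : A2cond κ h1 h2)
    (p : ℤ × ℤ) (m : ℕ) (t : ℝ) :
    psiNode κ h1 h2 p (m + 1) (t, (p.2 : ℝ) * h2) =
      if t ∈ Icc (((p.1 : ℝ) - 1) * h1) (((p.1 : ℝ) + 1) * h1) then
        Complex.sin (((2 * m + 1) * π / (2 * h1) : ℝ) * ((t + (h1 - p.1 * h1) : ℝ) : ℂ))
      else 0 := by
  have hy : (p.2 : ℝ) * h2 ∈ Icc ((p.2 : ℝ) * h2) (((p.2 : ℝ) + 1) * h2) :=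
    ⟨le_rfl, by nlinarith⟩
  have hy' : (p.2 : ℝ) * h2 ∈ Icc (((p.2 : ℝ) - 1) * h2) ((p.2 : ℝ) * h2) :=
    ⟨by nlinarith, le_rfl⟩
  have hs := sin_csqrt_ne_zero hκ hh2 hA2 (2 * (m + 1) - 1)
  by_cases ht : t ∈ Icc (((p.1 : ℝ) - 1) * h1) (((p.1 : ℝ) + 1) * h1)
  · rw [if_pos ht, psiNode, if_pos ⟨ht, hy⟩, phiHat, sub_self, add_zero, mul_div_assoc,
      div_self hs, mul_one, mul_nuHat_odd hκ, show h1 - ((p.1 : ℝ) * h1 - t) =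
        t + (h1 - p.1 * h1) by ring]
  · rw [if_neg ht, psiNode, if_neg (fun h => ht h.1), if_neg (fun h => ht h.1)]

lemma pdM_even_psiNode {κ h1 h2 : ℝ} (hκ : 0 < κ) (hh1 : 0 < h1) (hh2 : 0 < h2)
    (hA2 : A2cond κ h1 h2) (p q : ℤ × ℤ) (m n : ℕ) :
    pdM (2 * n) 0 (psiNode κ h1 h2 p (m + 1)) (nodePt h1 h2 q) =
      if p = q then (-1 : ℂ) ^ m * (-(((2 * m + 1) * π / (2 * h1) : ℝ) : ℂ) ^ 2) ^ n else 0 := by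
  set c : ℝ := (2 * m + 1) * π / (2 * h1) with hc
  have hcr : ∀ x : ℝ, c * (x * h1) = x * ((2 * m + 1) * π / 2) := by
    intro x; rw [hc]; field_simp
  rw [pdM, Function.iterate_zero, id, nodePt, pd1_iterate_apply]
  by_cases hrow : q.2 = p.2
  · have hfun : (fun t => psiNode κ h1 h2 p (m + 1) (t, (q.2 : ℝ) * h2)) = fun t =>
        if t ∈ Icc (((p.1 : ℝ) - 1) * h1) (((p.1 : ℝ) + 1) * h1) then
          Complex.sin ((c : ℂ) * ((t + (h1 - p.1 * h1) : ℝ) : ℂ)) else 0 := by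
      funext t
      rw [hrow]
      exact psiNode_row hκ hh2 hA2 p m t
    rw [hfun]
    rcases lt_trichotomy q.1 p.1 with hlt | heq | hgt
    · rw [if_neg (by rintro rfl; exact lt_irrefl _ hlt)]
      refine iterate_deriv_eq_zero_of_eqOn_Iic (a := ((p.1 : ℝ) - 1) * h1) _ ?_ _ ?_
      · intro t ht
        split_ifs with h
        · have : t = ((p.1 : ℝ) - 1) * h1 := le_antisymm ht h.1
          rw [this, show ((p.1 : ℝ) - 1) * h1 + (h1 - p.1 * h1) = 0 by ring]
          simp
        · rfl
      · have : (q.1 : ℝ) ≤ p.1 - 1 := by exact_mod_cast Int.le_sub_one_of_lt hlt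
        exact mul_le_mul_of_nonneg_right this hh1.le
    · have hpq : p = q := Prod.ext heq.symm hrow.symm
      subst hpq
      rw [if_pos rfl]
      have hev : (fun t : ℝ => if t ∈ Icc (((p.1 : ℝ) - 1) * h1) (((p.1 : ℝ) + 1) * h1) then
          Complex.sin ((c : ℂ) * ((t + (h1 - p.1 * h1) : ℝ) : ℂ)) else 0)
          =ᶠ[nhds ((p.1 : ℝ) * h1)]
          fun t : ℝ => 1 * Complex.sin ((c : ℂ) * ((t + (h1 - p.1 * h1) : ℝ) : ℂ)) := by
        filter_upwards [Icc_mem_nhds (a := ((p.1 : ℝ) - 1) * h1) (b := ((p.1 : ℝ) + 1) * h1)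
          (by nlinarith) (by nlinarith)] with t ht
        rw [if_pos ht, one_mul]
      rw [(iterate_deriv_eventuallyEq (2 * n) hev).eq_of_nhds, iterate_deriv_sin_affine]
      have hsin : Complex.sin ((c : ℂ) * (((p.1 : ℝ) * h1 + (h1 - p.1 * h1) : ℝ) : ℂ)) =
          (-1 : ℂ) ^ m := by
        have h2 : c * ((p.1 : ℝ) * h1 + (h1 - p.1 * h1)) = m * π + π / 2 := by
          have := hcr 1
          rw [one_mul, one_mul] at this
          rw [show (p.1 : ℝ) * h1 + (h1 - p.1 * h1) = h1 by ring, this]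
          ring
        rw [← Complex.ofReal_mul, h2, ← Complex.ofReal_sin, Real.sin_add_pi_div_two,
          Real.cos_nat_mul_pi]
        push_cast
        rfl
      simp only [hsin]
      ring
    · rw [if_neg (by rintro rfl; exact lt_irrefl _ hgt)]
      refine iterate_deriv_eq_zero_of_eqOn_Ici (a := ((p.1 : ℝ) + 1) * h1) _ ?_ _ ?_
      · intro t ht
        split_ifs with h
        · have : t = ((p.1 : ℝ) + 1) * h1 := le_antisymm h.2 ht
          have h2 : c * (((p.1 : ℝ) + 1) * h1 + (h1 - p.1 * h1)) = ((2 * m + 1 : ℕ) : ℝ) * π := by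
            have := hcr 2
            rw [show ((p.1 : ℝ) + 1) * h1 + (h1 - p.1 * h1) = 2 * h1 by ring, this]
            push_cast
            ring
          rw [this, ← Complex.ofReal_mul, h2, ← Complex.ofReal_sin, Real.sin_nat_mul_pi,
            Complex.ofReal_zero]
        · rfl
      · have : (p.1 : ℝ) + 1 ≤ q.1 := by exact_mod_cast hgt
        exact mul_le_mul_of_nonneg_right this hh1.le
  · rw [if_neg (by rintro rfl; exact hrow rfl)]
    exact iterate_deriv_eq_zero_of_eqOn_Iic (a := (q.1 : ℝ) * h1) _
      (fun t _ => psiNode_eq_zero_of_row_ne hh2 hrow _ t) _ le_rfl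

/-! ### Dual Lagrange functionals for Vandermonde systems with negative nodes -/

lemma coeff_prod_X_add_C_nonneg (s : Finset ℕ) (w : ℕ → ℝ) (hw : ∀ j, 0 ≤ w j) (n : ℕ) :
    0 ≤ (∏ j ∈ s, (Polynomial.X + Polynomial.C (w j))).coeff n := by
  induction s using Finset.induction_on generalizing n with
  | empty =>
    rw [Finset.prod_empty, Polynomial.coeff_one]
    split_ifs <;> norm_num
  | insert a s ha ih =>
    rw [Finset.prod_insert ha, add_mul, Polynomial.coeff_add, Polynomial.coeff_C_mul]
    refine add_nonneg ?_ (mul_nonneg (hw a) (ih n))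
    cases n with
    | zero => simp
    | succ n => rw [Polynomial.coeff_X_mul]; exact ih n

lemma natDegree_prod_X_add_C_erase_lt {N m : ℕ} (hm : m < N) (w : ℕ → ℝ) :
    (∏ j ∈ (Finset.range N).erase m, (Polynomial.X + Polynomial.C (w j))).natDegree < N := by
  rw [Polynomial.natDegree_prod_of_monic _ _ fun j _ => Polynomial.monic_X_add_C _]
  simp only [Polynomial.natDegree_X_add_C, Finset.sum_const, smul_eq_mul, mul_one]
  rw [Finset.card_erase_of_mem (Finset.mem_range.mpr hm), Finset.card_range]
  omega

/-- The `m`-th coefficient of a solution of a Vandermonde system with nodes `-w_j` is bounded by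
the right-hand side times the `ℓ¹`-norm of the coefficients of the `m`-th Lagrange polynomial. -/
lemma norm_vandermonde_solution_le {N m : ℕ} (hm : m < N) {w : ℕ → ℝ} (hw : ∀ j, 0 ≤ w j)
    (hinj : Function.Injective w) {g b : ℕ → ℂ} {B : ℝ} (hB : ∀ n < N, ‖b n‖ ≤ B)
    (hsys : ∀ n < N, ∑ j ∈ Finset.range N, g j * (-(w j : ℂ)) ^ n = b n) :
    ‖g m‖ ≤ (∏ j ∈ (Finset.range N).erase m, (1 + w j) / |w j - w m|) * B := by
  set P : Polynomial ℝ := ∏ j ∈ (Finset.range N).erase m, (Polynomial.X + Polynomial.C (w j))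
    with hP
  have hdeg : P.natDegree < N := natDegree_prod_X_add_C_erase_lt hm w
  have heval : ∀ x : ℝ, ∑ n ∈ Finset.range N, P.coeff n * x ^ n =
      ∏ j ∈ (Finset.range N).erase m, (x + w j) := by
    intro x
    rw [← Polynomial.eval_eq_sum_range' hdeg, hP, Polynomial.eval_prod]
    simp
  have hcomb : ∑ n ∈ Finset.range N, (P.coeff n : ℂ) * b n =
      g m * ((∏ j ∈ (Finset.range N).erase m, (w j - w m) : ℝ) : ℂ) := by
    calc ∑ n ∈ Finset.range N, (P.coeff n : ℂ) * b n
        = ∑ n ∈ Finset.range N, ∑ j ∈ Finset.range N,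
            g j * ((P.coeff n : ℂ) * (-(w j : ℂ)) ^ n) := by
          refine Finset.sum_congr rfl fun n hn => ?_
          rw [← hsys n (Finset.mem_range.mp hn), Finset.mul_sum]
          exact Finset.sum_congr rfl fun j _ => by ring
      _ = ∑ j ∈ Finset.range N, g j *
            ((∏ i ∈ (Finset.range N).erase m, (-w j + w i) : ℝ) : ℂ) := by
          rw [Finset.sum_comm]
          refine Finset.sum_congr rfl fun j _ => ?_
          rw [← Finset.mul_sum, ← heval]
          push_cast
          rfl
      _ = g m * ((∏ j ∈ (Finset.range N).erase m, (w j - w m) : ℝ) : ℂ) := by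
          rw [Finset.sum_eq_single_of_mem m (Finset.mem_range.mpr hm)]
          · congr 2
            exact Finset.prod_congr rfl fun i _ => by ring
          · intro j hj hjm
            rw [Finset.prod_eq_zero (Finset.mem_erase.mpr ⟨hjm, hj⟩) (by ring)]
            simp
  have hnorm : ‖∑ n ∈ Finset.range N, (P.coeff n : ℂ) * b n‖ ≤
      (∏ j ∈ (Finset.range N).erase m, (1 + w j)) * B := by
    rw [← heval 1, Finset.sum_mul]
    refine norm_sum_le_of_le _ fun n hn => ?_
    rw [norm_mul, Complex.norm_real, Real.norm_of_nonneg (coeff_prod_X_add_C_nonneg _ w hw n),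
      one_pow, mul_one]
    exact mul_le_mul_of_nonneg_left (hB n (Finset.mem_range.mp hn))
      (coeff_prod_X_add_C_nonneg _ w hw n)
  rw [hcomb, norm_mul, Complex.norm_real, Real.norm_eq_abs, Finset.abs_prod] at hnorm
  have hpos : 0 < ∏ j ∈ (Finset.range N).erase m, |w j - w m| :=
    Finset.prod_pos fun j hj => abs_pos.mpr (sub_ne_zero.mpr (hinj.ne (Finset.ne_of_mem_erase hj)))
  rw [Finset.prod_div_distrib, div_mul_eq_mul_div, le_div_iff₀ hpos]
  exact hnorm

lemma exists_vandermonde_solution (N : ℕ) {w : ℕ → ℝ} (hinj : Function.Injective w) (b : ℕ → ℂ) :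
    ∃ g : ℕ → ℂ, ∀ n < N, ∑ j ∈ Finset.range N, g j * (-(w j : ℂ)) ^ n = b n := by
  set V : Matrix (Fin N) (Fin N) ℂ := Matrix.vandermonde fun j : Fin N => -(w j : ℂ) with hV
  have hdet : IsUnit V.det := by
    rw [isUnit_iff_ne_zero, hV, Matrix.det_vandermonde_ne_zero_iff]
    intro i j hij
    exact Fin.ext (hinj (by exact_mod_cast neg_injective hij))
  set x : Fin N → ℂ := Matrix.vecMul (fun n : Fin N => b n) V⁻¹ with hx
  have hxV : Matrix.vecMul x V = fun n : Fin N => b n := by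
    rw [hx, Matrix.vecMul_vecMul, Matrix.nonsing_inv_mul _ hdet, Matrix.vecMul_one]
  refine ⟨fun j => if h : j < N then x ⟨j, h⟩ else 0, fun n hn => ?_⟩
  have := congrFun hxV ⟨n, hn⟩
  rw [← this, Matrix.vecMul, dotProduct, Finset.sum_range]
  refine Finset.sum_congr rfl fun j _ => ?_
  simp [hV, Matrix.vandermonde_apply]

/-! ### Product estimates for the odd nodes -/

lemma tendsto_sinh_prod (x : ℝ) :
    Filter.Tendsto (fun n : ℕ => π * x * ∏ j ∈ Finset.range n, (1 + x ^ 2 / ((j : ℝ) + 1) ^ 2))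
      Filter.atTop (nhds (Real.sinh (π * x))) := by
  have h := (Complex.continuous_im.tendsto _).comp
    (Complex.tendsto_euler_sin_prod ((x : ℂ) * Complex.I))
  have hlim : (Complex.sin (π * ((x : ℂ) * Complex.I))).im = Real.sinh (π * x) := by
    rw [← mul_assoc, ← Complex.ofReal_mul, Complex.sin_mul_I, ← Complex.ofReal_sinh,
      Complex.im_ofReal_mul, Complex.I_im, mul_one]
  rw [hlim] at h
  refine h.congr fun n => ?_
  have : ∏ j ∈ Finset.range n, ((1 : ℂ) - ((x : ℂ) * Complex.I) ^ 2 / ((j : ℂ) + 1) ^ 2) =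
      ((∏ j ∈ Finset.range n, (1 + x ^ 2 / ((j : ℝ) + 1) ^ 2) : ℝ) : ℂ) := by
    push_cast
    refine Finset.prod_congr rfl fun j _ => ?_
    rw [mul_pow, Complex.I_sq]
    ring
  rw [Function.comp_apply, this, show (π : ℂ) * (x * Complex.I) *
    ((∏ j ∈ Finset.range n, (1 + x ^ 2 / ((j : ℝ) + 1) ^ 2) : ℝ) : ℂ) =
    ((π * x * ∏ j ∈ Finset.range n, (1 + x ^ 2 / ((j : ℝ) + 1) ^ 2) : ℝ) : ℂ) * Complex.I by
      push_cast; ring]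
  rw [Complex.im_ofReal_mul, Complex.I_im, mul_one]

lemma prod_range_two_mul (f : ℕ → ℝ) (n : ℕ) :
    ∏ j ∈ Finset.range (2 * n), f j =
      (∏ j ∈ Finset.range n, f (2 * j)) * ∏ j ∈ Finset.range n, f (2 * j + 1) := by
  induction n with
  | zero => simp
  | succ n ih =>
    rw [show 2 * (n + 1) = 2 * n + 1 + 1 by ring, Finset.prod_range_succ, Finset.prod_range_succ,
      Finset.prod_range_succ, Finset.prod_range_succ, ih]
    ring

lemma prod_odd_le_cosh {a : ℝ} (ha : 0 < a) (N : ℕ) :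
    ∏ j ∈ Finset.range N, (1 + a ^ 2 / (2 * (j : ℝ) + 1) ^ 2) ≤ Real.cosh (π * a / 2) := by
  have hs : 0 < Real.sinh (π * (a / 2)) := Real.sinh_pos_iff.mpr (by positivity)
  have h2n : Filter.Tendsto (fun n : ℕ => 2 * n) Filter.atTop Filter.atTop :=
    Filter.tendsto_id.const_mul_atTop' (by norm_num)
  have hlim := (((tendsto_sinh_prod a).comp h2n).div (tendsto_sinh_prod (a / 2)) hs.ne').const_mul
    (1 / 2 : ℝ)
  have hval : (1 / 2 : ℝ) * (Real.sinh (π * a) / Real.sinh (π * (a / 2))) =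
      Real.cosh (π * a / 2) := by
    rw [show π * a = 2 * (π * (a / 2)) by ring, Real.sinh_two_mul,
      show 2 * (π * (a / 2)) / 2 = π * (a / 2) by ring]
    field_simp
  rw [hval] at hlim
  have hcongr : ∀ n : ℕ, (1 / 2 : ℝ) *
      ((π * a * ∏ j ∈ Finset.range (2 * n), (1 + a ^ 2 / ((j : ℝ) + 1) ^ 2)) /
        (π * (a / 2) * ∏ j ∈ Finset.range n, (1 + (a / 2) ^ 2 / ((j : ℝ) + 1) ^ 2))) =
      ∏ j ∈ Finset.range n, (1 + a ^ 2 / (2 * (j : ℝ) + 1) ^ 2) := by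
    intro n
    have hodd : ∏ j ∈ Finset.range n, (1 + a ^ 2 / (((2 * j + 1 : ℕ) : ℝ) + 1) ^ 2) =
        ∏ j ∈ Finset.range n, (1 + (a / 2) ^ 2 / ((j : ℝ) + 1) ^ 2) := by
      refine Finset.prod_congr rfl fun j _ => ?_
      push_cast
      have : (j : ℝ) + 1 ≠ 0 := by positivity
      rw [show 2 * (j : ℝ) + 1 + 1 = 2 * (j + 1) by ring]
      field_simp
    rw [prod_range_two_mul, hodd]
    have hpos : 0 < ∏ j ∈ Finset.range n, (1 + (a / 2) ^ 2 / ((j : ℝ) + 1) ^ 2) :=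
      Finset.prod_pos fun j _ => by positivity
    push_cast
    field_simp
  refine (monotone_nat_of_le_succ fun n => ?_).ge_of_tendsto (hlim.congr hcongr) N
  rw [Finset.prod_range_succ]
  exact le_mul_of_one_le_right (Finset.prod_nonneg fun j _ => by positivity)
    (le_add_of_nonneg_right (by positivity))

lemma prod_odd_sq_eq (n : ℕ) :
    Real.Wallis.W n * ((∏ j ∈ Finset.range (n + 1), (2 * (j : ℝ) + 1)) ^ 2) =
      4 ^ n * (n.factorial : ℝ) ^ 2 * (2 * n + 1) := by
  induction n with
  | zero => simp [Real.Wallis.W]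
  | succ n ih =>
    rw [Real.Wallis.W_succ, Finset.prod_range_succ, mul_pow, Nat.factorial_succ]
    push_cast
    rw [show Real.Wallis.W n * ((2 * (n : ℝ) + 2) / (2 * n + 1) * ((2 * n + 2) / (2 * n + 3))) *
      ((∏ j ∈ Finset.range (n + 1), (2 * (j : ℝ) + 1)) ^ 2 * (2 * ((n : ℝ) + 1) + 1) ^ 2) =
      (Real.Wallis.W n * ((∏ j ∈ Finset.range (n + 1), (2 * (j : ℝ) + 1)) ^ 2)) *
      ((2 * (n : ℝ) + 2) / (2 * n + 1) * ((2 * n + 2) / (2 * n + 3))) *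
        (2 * ((n : ℝ) + 1) + 1) ^ 2 by ring, ih]
    field_simp
    ring

/-- Wallis' estimate `((2n+1)!!)² π ≤ 4^(n+1) n! (n+1)!`. -/
lemma prod_odd_sq_mul_pi_le (n : ℕ) :
    (∏ j ∈ Finset.range (n + 1), (2 * (j : ℝ) + 1)) ^ 2 * π ≤
      4 ^ (n + 1) * ((n.factorial : ℝ) * ((n + 1).factorial : ℝ)) := by
  have h1 := prod_odd_sq_eq n
  have h2 := Real.Wallis.le_W n
  set P := (∏ j ∈ Finset.range (n + 1), (2 * (j : ℝ) + 1)) ^ 2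
  have hP : 0 ≤ P := by positivity
  have h3 := mul_le_mul_of_nonneg_right h2 hP
  rw [h1] at h3
  have h4 : P * π * ((2 * (n : ℝ) + 1) / (2 * n + 2) / 2) ≤
      4 ^ n * (n.factorial : ℝ) ^ 2 * (2 * n + 1) := by linarith
  have h5 : (4 : ℝ) ^ n * (n.factorial : ℝ) ^ 2 * (2 * n + 1) =
      4 ^ (n + 1) * ((n.factorial : ℝ) * ((n + 1).factorial : ℝ)) * ((2 * (n : ℝ) + 1) / (2 * n + 2) / 2) := by
    rw [Nat.factorial_succ]
    push_cast
    field_simp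
    ring
  rw [h5] at h4
  exact le_of_mul_le_mul_right h4 (by positivity)

lemma factorial_mul_factorial_le {k c : ℕ} (hkc : k ≤ c) (i : ℕ) :
    (k + i).factorial * c.factorial ≤ k.factorial * (c + i).factorial := by
  induction i with
  | zero => rfl
  | succ i ih =>
    rw [← add_assoc, ← add_assoc, Nat.factorial_succ, Nat.factorial_succ]
    calc (k + i + 1) * (k + i).factorial * c.factorial
        = (k + i + 1) * ((k + i).factorial * c.factorial) := by ring
      _ ≤ (c + i + 1) * (k.factorial * (c + i).factorial) := by gcongr
      _ = _ := by ring

lemma prod_odd_sq_sub_range (m : ℕ) :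
    ∏ j ∈ Finset.range m, |(2 * (j : ℝ) + 1) ^ 2 - (2 * (m : ℝ) + 1) ^ 2| =
      4 ^ m * ((2 * m).factorial : ℝ) := by
  have h1 : ∀ j ∈ Finset.range m, |(2 * (j : ℝ) + 1) ^ 2 - (2 * (m : ℝ) + 1) ^ 2| =
      4 * (((m - j : ℕ) : ℝ) * ((m + 1 + j : ℕ) : ℝ)) := by
    intro j hj
    have hjm : j ≤ m := (Finset.mem_range.mp hj).le
    have hjm' : (j : ℝ) ≤ m := by exact_mod_cast hjm
    rw [abs_of_nonpos (by nlinarith), Nat.cast_sub hjm]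
    push_cast
    ring
  rw [Finset.prod_congr rfl h1, Finset.prod_mul_distrib, Finset.prod_const, Finset.card_range,
    Finset.prod_mul_distrib, ← Nat.cast_prod, ← Nat.cast_prod, ← Nat.descFactorial_eq_prod_range,
    ← Nat.ascFactorial_eq_prod_range, Nat.descFactorial_self, ← Nat.cast_mul,
    Nat.factorial_mul_ascFactorial, two_mul]

lemma prod_odd_sq_sub (m k : ℕ) :
    (2 * (m : ℝ) + 1) * ∏ j ∈ (Finset.range (m + k + 1)).erase m,
        |(2 * (j : ℝ) + 1) ^ 2 - (2 * (m : ℝ) + 1) ^ 2| =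
      4 ^ (m + k) * ((k.factorial : ℝ) * ((m + k + 1 + m).factorial : ℝ)) := by
  induction k with
  | zero =>
    rw [add_zero, Finset.range_add_one, Finset.erase_insert (by simp), prod_odd_sq_sub_range,
      show m + 1 + m = 2 * m + 1 by ring, Nat.factorial_succ (2 * m)]
    push_cast
    ring
  | succ k ih =>
    have hx : |(2 * ((m + k + 1 : ℕ) : ℝ) + 1) ^ 2 - (2 * (m : ℝ) + 1) ^ 2| =
        4 * ((k + 1 : ℝ) * (m + k + 1 + m + 1)) := by
      have hx' : (2 * ((m + k + 1 : ℕ) : ℝ) + 1) ^ 2 - (2 * (m : ℝ) + 1) ^ 2 =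
          4 * ((k + 1 : ℝ) * (m + k + 1 + m + 1)) := by
        push_cast
        ring
      rw [hx', abs_of_nonneg (by positivity)]
    rw [← add_assoc, Finset.range_add_one, Finset.erase_insert_of_ne (by omega),
      Finset.prod_insert (by simp), mul_left_comm, ih, hx,
      show m + k + 1 + 1 + m = (m + k + 1 + m) + 1 by ring, Nat.factorial_succ (m + k + 1 + m),
      Nat.factorial_succ k]
    push_cast
    ring

lemma prod_odd_ratio_le {m N : ℕ} (hm : m < N) :
    ∏ j ∈ (Finset.range N).erase m,
        (2 * (j : ℝ) + 1) ^ 2 / |(2 * (j : ℝ) + 1) ^ 2 - (2 * (m : ℝ) + 1) ^ 2| ≤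
      4 / (π * (2 * m + 1)) := by
  obtain ⟨k, rfl⟩ : ∃ k, N = m + k + 1 := ⟨N - m - 1, by omega⟩
  have h1 := prod_odd_sq_mul_pi_le (m + k)
  rw [← Finset.mul_prod_erase _ _ (Finset.mem_range.mpr hm), mul_pow, ← Finset.prod_pow] at h1
  have h2 := prod_odd_sq_sub m k
  have h3 : ((m + k).factorial : ℝ) * ((m + k + 1).factorial : ℝ) ≤
      (k.factorial : ℝ) * ((m + k + 1 + m).factorial : ℝ) := by
    have := factorial_mul_factorial_le (k := k) (c := m + k + 1) (by omega) m
    rw [add_comm k m] at this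
    exact_mod_cast this
  rw [Finset.prod_div_distrib]
  set D := ∏ j ∈ (Finset.range (m + k + 1)).erase m,
    |(2 * (j : ℝ) + 1) ^ 2 - (2 * (m : ℝ) + 1) ^ 2|
  set E := ∏ j ∈ (Finset.range (m + k + 1)).erase m, (2 * (j : ℝ) + 1) ^ 2
  have hm0 : 0 < 2 * (m : ℝ) + 1 := by positivity
  have hD : 0 < D := by
    have : 0 < (2 * (m : ℝ) + 1) * D := by rw [h2]; positivity
    exact (pos_iff_pos_of_mul_pos this).mp hm0
  rw [div_le_div_iff₀ hD (by positivity)]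
  refine le_of_mul_le_mul_left ?_ hm0
  calc (2 * (m : ℝ) + 1) * (E * (π * (2 * m + 1))) = (2 * (m : ℝ) + 1) ^ 2 * E * π := by ring
    _ ≤ 4 ^ (m + k + 1) * (((m + k).factorial : ℝ) * ((m + k + 1).factorial : ℝ)) := h1
    _ ≤ 4 ^ (m + k + 1) * ((k.factorial : ℝ) * ((m + k + 1 + m).factorial : ℝ)) := by gcongr
    _ = 4 * ((2 * (m : ℝ) + 1) * D) := by rw [h2]; ring
    _ = (2 * (m : ℝ) + 1) * (4 * D) := by ring

lemma cosh_one_mul_le : Real.cosh 1 * (4 / π) ≤ Real.exp 1 := by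
  have he : (2 : ℝ) ≤ Real.exp 1 := by linarith [Real.add_one_le_exp (1 : ℝ)]
  have hc : Real.cosh 1 ≤ 3 / 4 * Real.exp 1 := by
    rw [Real.cosh_eq, Real.exp_neg]
    have : (Real.exp 1)⁻¹ ≤ 2⁻¹ := inv_anti₀ (by norm_num) he
    linarith
  have hp : 4 / π ≤ 4 / 3 := div_le_div_of_nonneg_left (by norm_num) (by norm_num) Real.pi_gt_three.le
  calc Real.cosh 1 * (4 / π) ≤ (3 / 4 * Real.exp 1) * (4 / 3) := by gcongr
    _ = Real.exp 1 := by ring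

/-- Row bound for the inverse of the Vandermonde matrix in the squared frequencies
`ν_j = (2j+1)π/(2t)`. -/
lemma node_prod_bound {t M : ℝ} (ht : 0 < t) (hM : 1 ≤ M) (htM : t ≤ M) {m N : ℕ} (hm : m < N) :
    ∏ j ∈ (Finset.range N).erase m, (1 + ((2 * (j : ℝ) + 1) * π / (2 * t)) ^ 2) /
        |((2 * (j : ℝ) + 1) * π / (2 * t)) ^ 2 - ((2 * (m : ℝ) + 1) * π / (2 * t)) ^ 2| ≤
      min (Real.cosh t / t) (Real.exp 1 * M ^ (2 * (N - 1))) := by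
  have hπ := Real.pi_pos
  set a : ℝ := 2 * t / π with ha
  have ha0 : 0 < a := by positivity
  have hm0 : 0 < 2 * (m : ℝ) + 1 := by positivity
  have hν : ∀ x : ℝ, (x * π / (2 * t)) ^ 2 = x ^ 2 / a ^ 2 := by
    intro x; rw [ha]; field_simp
  have hterm : ∀ j ∈ (Finset.range N).erase m, (1 + ((2 * (j : ℝ) + 1) * π / (2 * t)) ^ 2) /
        |((2 * (j : ℝ) + 1) * π / (2 * t)) ^ 2 - ((2 * (m : ℝ) + 1) * π / (2 * t)) ^ 2| =
      (1 + a ^ 2 / (2 * (j : ℝ) + 1) ^ 2) *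
        ((2 * (j : ℝ) + 1) ^ 2 / |(2 * (j : ℝ) + 1) ^ 2 - (2 * (m : ℝ) + 1) ^ 2|) := by
    intro j _
    have hj0 : 2 * (j : ℝ) + 1 ≠ 0 := by positivity
    rw [hν, hν, ← sub_div, abs_div, abs_of_pos (by positivity : 0 < a ^ 2), div_div_eq_mul_div,
      mul_div_assoc']
    congr 1
    field_simp
    ring
  rw [Finset.prod_congr rfl hterm, Finset.prod_mul_distrib]
  have hQ := prod_odd_ratio_le hm
  set Q := ∏ j ∈ (Finset.range N).erase m,
        (2 * (j : ℝ) + 1) ^ 2 / |(2 * (j : ℝ) + 1) ^ 2 - (2 * (m : ℝ) + 1) ^ 2|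
  have hsplit : ∀ b : ℝ, 0 < b → (1 + b ^ 2 / (2 * (m : ℝ) + 1) ^ 2) *
      ∏ j ∈ (Finset.range N).erase m, (1 + b ^ 2 / (2 * (j : ℝ) + 1) ^ 2) ≤
      Real.cosh (π * b / 2) := by
    intro b hb
    rw [Finset.mul_prod_erase (Finset.range N) (fun j : ℕ => 1 + b ^ 2 / (2 * (j : ℝ) + 1) ^ 2)
      (Finset.mem_range.mpr hm)]
    exact prod_odd_le_cosh hb N
  have hPnn : ∀ b : ℝ, 0 ≤ ∏ j ∈ (Finset.range N).erase m, (1 + b ^ 2 / (2 * (j : ℝ) + 1) ^ 2) :=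
    fun b => Finset.prod_nonneg fun j _ => by positivity
  refine le_min ?_ ?_
  · have h1 := hsplit a ha0
    rw [show π * a / 2 = t by rw [ha]; field_simp] at h1
    set P := ∏ j ∈ (Finset.range N).erase m, (1 + a ^ 2 / (2 * (j : ℝ) + 1) ^ 2)
    have hP : 0 ≤ P := hPnn a
    have h2 : 4 / (π * (2 * m + 1)) ≤ (1 + a ^ 2 / (2 * (m : ℝ) + 1) ^ 2) * (1 / t) := by
      rw [show (1 : ℝ) / t = 2 / (π * a) by rw [ha]; field_simp,
        show (1 + a ^ 2 / (2 * (m : ℝ) + 1) ^ 2) * (2 / (π * a)) =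
          (((2 * m + 1) ^ 2 + a ^ 2) * 2) / (π * a * (2 * m + 1) ^ 2) by field_simp,
        div_le_div_iff₀ (by positivity) (by positivity)]
      have : 0 ≤ π * (2 * m + 1) * ((2 * (m : ℝ) + 1) - a) ^ 2 := by positivity
      nlinarith
    calc P * Q ≤ P * ((1 + a ^ 2 / (2 * (m : ℝ) + 1) ^ 2) * (1 / t)) := by
          gcongr; exact hQ.trans h2
      _ = ((1 + a ^ 2 / (2 * (m : ℝ) + 1) ^ 2) * P) * (1 / t) := by ring
      _ ≤ Real.cosh t * (1 / t) := by gcongr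
      _ = Real.cosh t / t := by ring
  · have hb := hsplit (2 / π) (by positivity)
    rw [show π * (2 / π) / 2 = 1 by field_simp] at hb
    have hb' : ∏ j ∈ (Finset.range N).erase m, (1 + (2 / π) ^ 2 / (2 * (j : ℝ) + 1) ^ 2) ≤
        Real.cosh 1 :=
      (le_mul_of_one_le_left (hPnn _) (le_add_of_nonneg_right (by positivity))).trans hb
    have hP : ∏ j ∈ (Finset.range N).erase m, (1 + a ^ 2 / (2 * (j : ℝ) + 1) ^ 2) ≤
        M ^ (2 * (N - 1)) * Real.cosh 1 := by
      calc ∏ j ∈ (Finset.range N).erase m, (1 + a ^ 2 / (2 * (j : ℝ) + 1) ^ 2)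
          ≤ ∏ j ∈ (Finset.range N).erase m,
              M ^ 2 * (1 + (2 / π) ^ 2 / (2 * (j : ℝ) + 1) ^ 2) := by
            refine Finset.prod_le_prod (fun j _ => by positivity) fun j _ => ?_
            have h1 : (1 : ℝ) ≤ M ^ 2 := one_le_pow₀ hM
            have h2 : a ^ 2 ≤ M ^ 2 * (2 / π) ^ 2 := by
              rw [← mul_pow]
              refine pow_le_pow_left₀ ha0.le ?_ 2
              rw [ha, mul_div_assoc', mul_comm 2 t]
              gcongr
            rw [mul_add, mul_one, mul_div_assoc']
            gcongr
        _ = M ^ (2 * (N - 1)) *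
              ∏ j ∈ (Finset.range N).erase m, (1 + (2 / π) ^ 2 / (2 * (j : ℝ) + 1) ^ 2) := by
            rw [Finset.prod_mul_distrib, Finset.prod_const,
              Finset.card_erase_of_mem (Finset.mem_range.mpr hm), Finset.card_range, pow_mul]
        _ ≤ M ^ (2 * (N - 1)) * Real.cosh 1 := by gcongr
    have hQ' : Q ≤ 4 / π := by
      refine hQ.trans (div_le_div_of_nonneg_left (by norm_num) hπ ?_)
      exact le_mul_of_one_le_right hπ.le (by linarith [Nat.cast_nonneg (α := ℝ) m])
    have hM0 : 0 < M := by linarith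
    calc (∏ j ∈ (Finset.range N).erase m, (1 + a ^ 2 / (2 * (j : ℝ) + 1) ^ 2)) * Q
        ≤ (M ^ (2 * (N - 1)) * Real.cosh 1) * (4 / π) :=
          mul_le_mul hP hQ' (Finset.prod_nonneg fun j _ => by positivity)
            (mul_nonneg (by positivity) (Real.cosh_pos 1).le)
      _ = (Real.cosh 1 * (4 / π)) * M ^ (2 * (N - 1)) := by ring
      _ ≤ Real.exp 1 * M ^ (2 * (N - 1)) :=
          mul_le_mul_of_nonneg_right cosh_one_mul_le (by positivity)

/-! ### Calculus of partial derivatives -/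

lemma pd1_eq_fderiv {f : ℝ × ℝ → ℂ} (hf : Differentiable ℝ f) :
    pd1 f = fun x => fderiv ℝ f x (1, 0) := by
  funext x
  have h1 : HasDerivAt (fun t : ℝ => (t, x.2)) ((1 : ℝ), (0 : ℝ)) x.1 :=
    (hasDerivAt_id x.1).prodMk (hasDerivAt_const x.1 x.2)
  exact ((hf (x.1, x.2)).hasFDerivAt.comp_hasDerivAt x.1 h1).deriv

lemma pd2_eq_fderiv {f : ℝ × ℝ → ℂ} (hf : Differentiable ℝ f) :
    pd2 f = fun x => fderiv ℝ f x (0, 1) := by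
  funext x
  have h1 : HasDerivAt (fun t : ℝ => (x.1, t)) ((0 : ℝ), (1 : ℝ)) x.2 :=
    (hasDerivAt_const x.2 x.1).prodMk (hasDerivAt_id x.2)
  exact ((hf (x.1, x.2)).hasFDerivAt.comp_hasDerivAt x.2 h1).deriv

lemma contDiff_pd1 {f : ℝ × ℝ → ℂ} {k : ℕ} (hf : ContDiff ℝ (k + 1 : ℕ) f) :
    ContDiff ℝ k (pd1 f) := by
  rw [pd1_eq_fderiv (hf.differentiable (by norm_cast))]
  exact (hf.fderiv_right (m := k) (by norm_cast)).clm_apply contDiff_const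

lemma contDiff_pd2 {f : ℝ × ℝ → ℂ} {k : ℕ} (hf : ContDiff ℝ (k + 1 : ℕ) f) :
    ContDiff ℝ k (pd2 f) := by
  rw [pd2_eq_fderiv (hf.differentiable (by norm_cast))]
  exact (hf.fderiv_right (m := k) (by norm_cast)).clm_apply contDiff_const

lemma contDiff_pd1_iterate {f : ℝ × ℝ → ℂ} {k i : ℕ} (hf : ContDiff ℝ (k + i : ℕ) f) :
    ContDiff ℝ k (pd1^[i] f) := by
  induction i generalizing f with
  | zero => exact hf
  | succ i ih => exact ih (contDiff_pd1 hf)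

lemma pd2_pd1_comm {f : ℝ × ℝ → ℂ} (hf : ContDiff ℝ 2 f) : pd2 (pd1 f) = pd1 (pd2 f) := by
  have hd : Differentiable ℝ f := hf.differentiable (by norm_num)
  have hf' : ContDiff ℝ 1 (fderiv ℝ f) := hf.fderiv_right (by norm_num)
  have hdd : Differentiable ℝ (fderiv ℝ f) := hf'.differentiable (by norm_num)
  rw [pd1_eq_fderiv hd, pd2_eq_fderiv hd,
    pd2_eq_fderiv (hdd.clm_apply (differentiable_const _)),
    pd1_eq_fderiv (hdd.clm_apply (differentiable_const _))]
  funext x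
  rw [fderiv_clm_apply (hdd x) (differentiableAt_const _),
    fderiv_clm_apply (hdd x) (differentiableAt_const _)]
  have hsymm := (hf.contDiffAt (x := x)).isSymmSndFDerivAt (by simp)
  simpa using hsymm.eq (0, 1) (1, 0)

lemma pd2_pd1_iterate_comm {f : ℝ × ℝ → ℂ} {i : ℕ} (hf : ContDiff ℝ (i + 1 : ℕ) f) :
    pd2 (pd1^[i] f) = pd1^[i] (pd2 f) := by
  induction i with
  | zero => rfl
  | succ i ih =>
    rw [Function.iterate_succ_apply', Function.iterate_succ_apply', pd2_pd1_comm, ih]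
    · exact hf.of_le (by norm_cast; omega)
    · exact contDiff_pd1_iterate (k := 2) (by rwa [show 2 + i = i + 1 + 1 by omega])

/-! ### Pointwise Sobolev bound on a rectangle -/

lemma mul_norm_le_setIntegral {g : ℝ → ℂ} (hg : ContDiff ℝ 1 g) {a b x0 : ℝ}
    (hx0 : x0 ∈ Icc a b) :
    (b - a) * ‖g x0‖ ≤ ∫ x in Ioo a b, (‖g x‖ + (b - a) * ‖deriv g x‖) := by
  have hab : a ≤ b := hx0.1.trans hx0.2
  have hdc : Continuous (deriv g) := hg.continuous_deriv le_rfl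
  have hd : Differentiable ℝ g := hg.differentiable (by norm_num)
  rw [← integral_Icc_eq_integral_Ioo]
  have hint : ∀ {F : ℝ → ℝ}, Continuous F → IntegrableOn F (Icc a b) :=
    fun hF => hF.integrableOn_Icc
  set J := ∫ x in Icc a b, ‖deriv g x‖ with hJ
  have hpt : ∀ x ∈ Icc a b, ‖g x0‖ ≤ ‖g x‖ + J := by
    intro x hx
    have hftc : ∫ t in x..x0, deriv g t = g x0 - g x :=
      intervalIntegral.integral_deriv_eq_sub (fun t _ => hd t) (hdc.intervalIntegrable _ _)
    have h1 : ‖g x0 - g x‖ ≤ J := by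
      rw [← hftc]
      refine intervalIntegral.norm_integral_le_integral_norm_uIoc.trans ?_
      refine setIntegral_mono_set (hint hdc.norm)
        (Filter.Eventually.of_forall fun t => norm_nonneg _)
        (LE.le.eventuallyLE ?_)
      exact uIoc_subset_uIcc.trans (uIcc_subset_Icc hx hx0)
    have h2 := norm_add_le (g x) (g x0 - g x)
    rw [add_sub_cancel] at h2
    linarith
  have hconst : ∀ c : ℝ, ∫ _ in Icc a b, c = (b - a) * c := by
    intro c
    rw [setIntegral_const, measureReal_def, Real.volume_Icc, ENNReal.toReal_ofReal (by linarith),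
      smul_eq_mul]
  have h3 : ∫ _ in Icc a b, ‖g x0‖ ≤ ∫ x in Icc a b, (‖g x‖ + J) :=
    setIntegral_mono_on (hint continuous_const) (hint (by fun_prop)) measurableSet_Icc hpt
  rw [hconst, integral_add (hint (by fun_prop)) (hint continuous_const), hconst] at h3
  rw [integral_add (hint (by fun_prop)) (hint (by fun_prop)), integral_const_mul]
  exact h3

lemma contDiff_slice1 {f : ℝ × ℝ → ℂ} {k : WithTop ℕ∞} (hf : ContDiff ℝ k f) (y : ℝ) :
    ContDiff ℝ k fun t : ℝ => f (t, y) :=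
  hf.comp (contDiff_id.prodMk contDiff_const)

lemma contDiff_slice2 {f : ℝ × ℝ → ℂ} {k : WithTop ℕ∞} (hf : ContDiff ℝ k f) (x : ℝ) :
    ContDiff ℝ k fun t : ℝ => f (x, t) :=
  hf.comp (contDiff_const.prodMk contDiff_id)

lemma Continuous.integrableOn_Ioo_prod {F : ℝ × ℝ → ℝ} (hF : Continuous F) (a b c d : ℝ) :
    IntegrableOn F (Ioo a b ×ˢ Ioo c d) :=
  (hF.continuousOn.integrableOn_compact (isCompact_Icc.prod isCompact_Icc)).mono_set
    (prod_mono (Ioo_subset_Icc_self (a := a) (b := b)) (Ioo_subset_Icc_self (a := c) (b := d)))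

lemma area_mul_norm_le_setIntegral {v : ℝ × ℝ → ℂ} (hv : ContDiff ℝ 2 v) {a b c d x0 y0 : ℝ}
    (hx0 : x0 ∈ Icc a b) (hy0 : y0 ∈ Icc c d) :
    (b - a) * (d - c) * ‖v (x0, y0)‖ ≤
      ∫ x in Ioo a b ×ˢ Ioo c d, (‖v x‖ + (d - c) * ‖pd2 v x‖ +
        (b - a) * (‖pd1 v x‖ + (d - c) * ‖pd2 (pd1 v) x‖)) := by
  have hba : 0 ≤ b - a := sub_nonneg.mpr (hx0.1.trans hx0.2)
  have hdc : 0 ≤ d - c := sub_nonneg.mpr (hy0.1.trans hy0.2)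
  have hv1 : ContDiff ℝ 1 (pd1 v) := contDiff_pd1 (k := 1) (by exact_mod_cast hv)
  have hv2 : ContDiff ℝ 1 (pd2 v) := contDiff_pd2 (k := 1) (by exact_mod_cast hv)
  have hv12 : ContDiff ℝ 0 (pd2 (pd1 v)) := contDiff_pd2 (k := 0) (by exact_mod_cast hv1)
  have c0 := hv.continuous
  have c1 := hv1.continuous
  have c2 := hv2.continuous
  have c12 := hv12.continuous
  have hG : Continuous fun x : ℝ × ℝ => ‖v x‖ + (d - c) * ‖pd2 v x‖ +
      (b - a) * (‖pd1 v x‖ + (d - c) * ‖pd2 (pd1 v) x‖) := by fun_prop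
  have hGi := hG.integrableOn_Ioo_prod a b c d
  have hvol : (volume : Measure (ℝ × ℝ)) = (volume : Measure ℝ).prod volume := rfl
  rw [hvol] at hGi ⊢
  rw [setIntegral_prod _ hGi]
  have hGi' := hGi
  rw [IntegrableOn, ← Measure.prod_restrict] at hGi'
  have hx := mul_norm_le_setIntegral ((contDiff_slice1 hv y0).of_le (by norm_num)) hx0
  calc (b - a) * (d - c) * ‖v (x0, y0)‖ = (d - c) * ((b - a) * ‖v (x0, y0)‖) := by ring
    _ ≤ (d - c) * ∫ x in Ioo a b, (‖v (x, y0)‖ + (b - a) * ‖pd1 v (x, y0)‖) :=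
        mul_le_mul_of_nonneg_left hx hdc
    _ = ∫ x in Ioo a b, (d - c) * (‖v (x, y0)‖ + (b - a) * ‖pd1 v (x, y0)‖) :=
        (integral_const_mul _ _).symm
    _ ≤ _ := by
        refine setIntegral_mono_on ?_ hGi'.integral_prod_left measurableSet_Ioo fun x _ => ?_
        · exact (Continuous.integrableOn_Icc (by fun_prop)).mono_set Ioo_subset_Icc_self
        · have h0 := mul_norm_le_setIntegral ((contDiff_slice2 hv x).of_le (by norm_num)) hy0
          have h1 := mul_norm_le_setIntegral (contDiff_slice2 hv1 x) hy0
          have hi : ∀ {F : ℝ → ℝ}, Continuous F → IntegrableOn F (Ioo c d) :=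
            fun hF => hF.integrableOn_Icc.mono_set Ioo_subset_Icc_self
          change _ ≤ ∫ y in Ioo c d, (‖v (x, y)‖ + (d - c) * ‖pd2 v (x, y)‖ +
            (b - a) * (‖pd1 v (x, y)‖ + (d - c) * ‖pd2 (pd1 v) (x, y)‖))
          rw [integral_add (hi (by fun_prop)) (hi (by fun_prop)), integral_const_mul]
          calc (d - c) * (‖v (x, y0)‖ + (b - a) * ‖pd1 v (x, y0)‖)
              = (d - c) * ‖v (x, y0)‖ + (b - a) * ((d - c) * ‖pd1 v (x, y0)‖) := by ring
            _ ≤ _ := add_le_add h0 (mul_le_mul_of_nonneg_left h1 hba)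

/-- Cauchy–Schwarz against the constant function on a set of finite measure. -/
lemma sq_setIntegral_le {α : Type*} [MeasurableSpace α] {μ : Measure α} {s : Set α}
    (hs : μ s ≠ ⊤) {G : α → ℝ} (hG : IntegrableOn G s μ)
    (hG2 : IntegrableOn (fun x => G x ^ 2) s μ) :
    (∫ x in s, G x ∂μ) ^ 2 ≤ μ.real s * ∫ x in s, G x ^ 2 ∂μ := by
  set I := ∫ x in s, G x ∂μ with hI
  set A := μ.real s with hA
  have hA0 : 0 ≤ A := measureReal_nonneg
  have hcst : ∀ c : ℝ, IntegrableOn (fun _ => c) s μ := fun c => integrableOn_const hs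
  have key : 0 ≤ ∫ x in s, (A * G x - I) ^ 2 ∂μ := integral_nonneg fun x => sq_nonneg _
  have hexp : ∫ x in s, (A * G x - I) ^ 2 ∂μ =
      A * (A * (∫ x in s, G x ^ 2 ∂μ) - I ^ 2) := by
    have : ∀ x, (A * G x - I) ^ 2 = (A ^ 2 * G x ^ 2 - (2 * A * I) * G x) + I ^ 2 := fun x => by
      ring
    simp_rw [this]
    have hsub : IntegrableOn (fun x => A ^ 2 * G x ^ 2 - (2 * A * I) * G x) s μ :=
      (hG2.const_mul _).sub (hG.const_mul _)
    rw [integral_add hsub (hcst _), integral_sub (hG2.const_mul _) (hG.const_mul _), integral_const_mul, integral_const_mul,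
      setIntegral_const, ← hI, ← hA, smul_eq_mul]
    ring
  rw [hexp] at key
  rcases hA0.eq_or_lt with h0 | hpos
  · have hz : μ s = 0 := by
      rw [hA, measureReal_def, eq_comm, ENNReal.toReal_eq_zero_iff] at h0
      exact h0.resolve_right hs
    have : I = 0 := by rw [hI, Measure.restrict_eq_zero.mpr hz, integral_zero_measure]
    rw [this, ← h0]
    simp
  · exact sub_nonneg.mp (nonneg_of_mul_nonneg_right key hpos)

lemma norm_sq_le_weighted_setIntegral {v : ℝ × ℝ → ℂ} (hv : ContDiff ℝ 2 v)
    {κ M a b c d x0 y0 : ℝ} (hκ : 0 < κ) (hM : 1 ≤ M) (hab : a < b) (hcd : c < d)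
    (h1 : κ * (b - a) ≤ M) (h2 : κ * (d - c) ≤ M) (hx0 : x0 ∈ Icc a b) (hy0 : y0 ∈ Icc c d) :
    (b - a) * (d - c) * ‖v (x0, y0)‖ ^ 2 ≤
      4 * M ^ 4 * ∫ x in Ioo a b ×ˢ Ioo c d, (‖v x‖ ^ 2 + (κ ^ 2)⁻¹ * ‖pd2 v x‖ ^ 2 +
        ((κ ^ 2)⁻¹ * ‖pd1 v x‖ ^ 2 + (κ ^ 4)⁻¹ * ‖pd2 (pd1 v) x‖ ^ 2)) := by
  have hv1 : ContDiff ℝ 1 (pd1 v) := contDiff_pd1 (k := 1) (by exact_mod_cast hv)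
  have hv2 : ContDiff ℝ 1 (pd2 v) := contDiff_pd2 (k := 1) (by exact_mod_cast hv)
  have hv12 : ContDiff ℝ 0 (pd2 (pd1 v)) := contDiff_pd2 (k := 0) (by exact_mod_cast hv1)
  have c0 := hv.continuous
  have c1 := hv1.continuous
  have c2 := hv2.continuous
  have c12 := hv12.continuous
  have hba : 0 < b - a := sub_pos.mpr hab
  have hdc : 0 < d - c := sub_pos.mpr hcd
  set K := Ioo a b ×ˢ Ioo c d with hK
  set G : ℝ × ℝ → ℝ := fun x => ‖v x‖ + (d - c) * ‖pd2 v x‖ +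
      (b - a) * (‖pd1 v x‖ + (d - c) * ‖pd2 (pd1 v) x‖) with hGdef
  set S : ℝ × ℝ → ℝ := fun x => ‖v x‖ ^ 2 + (κ ^ 2)⁻¹ * ‖pd2 v x‖ ^ 2 +
        ((κ ^ 2)⁻¹ * ‖pd1 v x‖ ^ 2 + (κ ^ 4)⁻¹ * ‖pd2 (pd1 v) x‖ ^ 2) with hSdef
  have hG : Continuous G := by fun_prop
  have hS : Continuous S := by fun_prop
  have hvol : volume K = ENNReal.ofReal (b - a) * ENNReal.ofReal (d - c) := by
    rw [hK, Measure.volume_eq_prod, Measure.prod_prod, Real.volume_Ioo, Real.volume_Ioo]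
  have hvolr : volume.real K = (b - a) * (d - c) := by
    rw [measureReal_def, hvol, ENNReal.toReal_mul, ENNReal.toReal_ofReal hba.le,
      ENNReal.toReal_ofReal hdc.le]
  have hfin : volume K ≠ ⊤ := by
    rw [hvol]
    exact ENNReal.mul_ne_top ENNReal.ofReal_ne_top ENNReal.ofReal_ne_top
  have hGS : ∀ x, G x ^ 2 ≤ 4 * M ^ 4 * S x := by
    intro x
    have e1 : G x ≤ M ^ 2 * (‖v x‖ + κ⁻¹ * ‖pd2 v x‖ +
        (κ⁻¹ * ‖pd1 v x‖ + (κ ^ 2)⁻¹ * ‖pd2 (pd1 v) x‖)) := by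
      have i1 : (d - c) * ‖pd2 v x‖ ≤ M ^ 2 * (κ⁻¹ * ‖pd2 v x‖) := by
        have : d - c ≤ M ^ 2 * κ⁻¹ := by
          rw [← div_eq_mul_inv, le_div_iff₀ hκ]
          nlinarith
        nlinarith [norm_nonneg (pd2 v x)]
      have i2 : (b - a) * ‖pd1 v x‖ ≤ M ^ 2 * (κ⁻¹ * ‖pd1 v x‖) := by
        have : b - a ≤ M ^ 2 * κ⁻¹ := by
          rw [← div_eq_mul_inv, le_div_iff₀ hκ]
          nlinarith
        nlinarith [norm_nonneg (pd1 v x)]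
      have i3 : (b - a) * (d - c) * ‖pd2 (pd1 v) x‖ ≤
          M ^ 2 * ((κ ^ 2)⁻¹ * ‖pd2 (pd1 v) x‖) := by
        have : (b - a) * (d - c) ≤ M ^ 2 * (κ ^ 2)⁻¹ := by
          rw [← div_eq_mul_inv, le_div_iff₀ (by positivity)]
          calc (b - a) * (d - c) * κ ^ 2 = (κ * (b - a)) * (κ * (d - c)) := by ring
            _ ≤ M * M := mul_le_mul h1 h2 (by positivity) (by positivity)
            _ = M ^ 2 := by ring
        nlinarith [norm_nonneg (pd2 (pd1 v) x)]
      have i0 : ‖v x‖ ≤ M ^ 2 * ‖v x‖ :=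
        le_mul_of_one_le_left (norm_nonneg _) (one_le_pow₀ hM)
      rw [hGdef]
      linarith
    have e0 : 0 ≤ G x := by positivity
    have e2 : S x = ‖v x‖ ^ 2 + (κ⁻¹ * ‖pd2 v x‖) ^ 2 +
        ((κ⁻¹ * ‖pd1 v x‖) ^ 2 + ((κ ^ 2)⁻¹ * ‖pd2 (pd1 v) x‖) ^ 2) := by
      rw [hSdef]
      simp only [mul_pow, inv_pow, ← pow_mul]
    have e3 : ∀ p q r s : ℝ, (p + q + (r + s)) ^ 2 ≤ 4 * (p ^ 2 + q ^ 2 + (r ^ 2 + s ^ 2)) := by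
      intro p q r s
      nlinarith [sq_nonneg (p - q), sq_nonneg (p - r), sq_nonneg (p - s), sq_nonneg (q - r),
        sq_nonneg (q - s), sq_nonneg (r - s)]
    calc G x ^ 2 ≤ _ := pow_le_pow_left₀ e0 e1 2
      _ = M ^ 4 * (‖v x‖ + κ⁻¹ * ‖pd2 v x‖ +
        (κ⁻¹ * ‖pd1 v x‖ + (κ ^ 2)⁻¹ * ‖pd2 (pd1 v) x‖)) ^ 2 := by ring
      _ ≤ M ^ 4 * (4 * S x) := by
          rw [e2]
          exact mul_le_mul_of_nonneg_left (e3 _ _ _ _) (by positivity)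
      _ = _ := by ring
  have hA := area_mul_norm_le_setIntegral hv hx0 hy0
  have hCS := sq_setIntegral_le hfin (hG.integrableOn_Ioo_prod a b c d)
    ((hG.pow 2).integrableOn_Ioo_prod a b c d)
  have hmono : ∫ x in K, G x ^ 2 ≤ 4 * M ^ 4 * ∫ x in K, S x := by
    rw [← integral_const_mul]
    exact setIntegral_mono ((hG.pow 2).integrableOn_Ioo_prod a b c d)
      ((hS.integrableOn_Ioo_prod a b c d).const_mul _) hGS
  have harea : 0 < (b - a) * (d - c) := by positivity
  refine le_of_mul_le_mul_left ?_ harea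
  calc (b - a) * (d - c) * ((b - a) * (d - c) * ‖v (x0, y0)‖ ^ 2)
      = ((b - a) * (d - c) * ‖v (x0, y0)‖) ^ 2 := by ring
    _ ≤ (∫ x in K, G x) ^ 2 := pow_le_pow_left₀ (by positivity) hA 2
    _ ≤ (b - a) * (d - c) * ∫ x in K, G x ^ 2 := by rw [← hvolr]; exact hCS
    _ ≤ _ := mul_le_mul_of_nonneg_left hmono harea.le

/-- Pointwise bound of an even tangential derivative by the Sobolev norm of order `2N`. -/
lemma norm_pdM_even_le_sobNorm {κ M a b c d x0 y0 : ℝ} {N n : ℕ} {Ω : Set (ℝ × ℝ)}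
    {u : ℝ × ℝ → ℂ} (hreg : ContDiff ℝ (2 * N : ℕ) u) (hmem : MemSob (2 * N) Ω u) (hn : n < N)
    (hκ : 0 < κ) (hM : 1 ≤ M) (hab : a < b) (hcd : c < d)
    (h1 : κ * (b - a) ≤ M) (h2 : κ * (d - c) ≤ M) (hx0 : x0 ∈ Icc a b) (hy0 : y0 ∈ Icc c d)
    (hsub : Ioo a b ×ˢ Ioo c d ⊆ Ω) :
    (b - a) * (d - c) * ((κ⁻¹) ^ (2 * n) * ‖pdM (2 * n) 0 u (x0, y0)‖) ^ 2 ≤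
      4 * M ^ 4 * sobNormSq κ (2 * N) Ω u := by
  set K := Ioo a b ×ˢ Ioo c d with hK
  set v := pd1^[2 * n] u with hv
  have hreg' : ContDiff ℝ (2 * n + 2 : ℕ) u := hreg.of_le (by norm_cast; omega)
  have hvc : ContDiff ℝ 2 v :=
    contDiff_pd1_iterate (k := 2) (by rwa [show 2 + 2 * n = 2 * n + 2 by ring])
  have e0 : v = pdM (2 * n) 0 u := rfl
  have e1 : pd1 v = pdM (2 * n + 1) 0 u := by
    rw [hv, ← Function.iterate_succ_apply' pd1 (2 * n) u]; rfl
  have e2 : pd2 v = pdM (2 * n) 1 u :=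
    pd2_pd1_iterate_comm (hreg'.of_le (by norm_cast; omega))
  have e12 : pd2 (pd1 v) = pdM (2 * n + 1) 1 u := by
    rw [hv, ← Function.iterate_succ_apply' pd1 (2 * n) u]
    exact pd2_pd1_iterate_comm (by exact_mod_cast hreg')
  have hmain := norm_sq_le_weighted_setIntegral hvc hκ hM hab hcd h1 h2 hx0 hy0
  have hv1 : ContDiff ℝ 1 (pd1 v) := contDiff_pd1 (k := 1) (by exact_mod_cast hvc)
  have hv2 : ContDiff ℝ 1 (pd2 v) := contDiff_pd2 (k := 1) (by exact_mod_cast hvc)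
  have hv12 : ContDiff ℝ 0 (pd2 (pd1 v)) := contDiff_pd2 (k := 0) (by exact_mod_cast hv1)
  have hi : ∀ {w : ℝ × ℝ → ℂ}, Continuous w → ∀ C : ℝ,
      IntegrableOn (fun x => C * ‖w x‖ ^ 2) K := fun hw C =>
    Continuous.integrableOn_Ioo_prod (by fun_prop) a b c d
  have hi0 : IntegrableOn (fun x => ‖v x‖ ^ 2) K := by simpa using hi hvc.continuous 1
  have hsplit : ∫ x in K, (‖v x‖ ^ 2 + (κ ^ 2)⁻¹ * ‖pd2 v x‖ ^ 2 +
        ((κ ^ 2)⁻¹ * ‖pd1 v x‖ ^ 2 + (κ ^ 4)⁻¹ * ‖pd2 (pd1 v) x‖ ^ 2)) =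
      (∫ x in K, ‖v x‖ ^ 2) + (κ ^ 2)⁻¹ * (∫ x in K, ‖pd2 v x‖ ^ 2) +
        ((κ ^ 2)⁻¹ * (∫ x in K, ‖pd1 v x‖ ^ 2) +
          (κ ^ 4)⁻¹ * ∫ x in K, ‖pd2 (pd1 v) x‖ ^ 2) := by
    have j2 := hi hv2.continuous (κ ^ 2)⁻¹
    have j1 := hi hv1.continuous (κ ^ 2)⁻¹
    have j12 := hi hv12.continuous (κ ^ 4)⁻¹
    rw [integral_add, integral_add hi0 j2, integral_add j1 j12, integral_const_mul,
      integral_const_mul, integral_const_mul]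
    · exact hi0.add j2
    · exact j1.add j12
  have hmono : ∀ p ∈ idxLe (2 * N), ∫ x in K, ‖pdM p.1 p.2 u x‖ ^ 2 ≤
      ∫ x in Ω, ‖pdM p.1 p.2 u x‖ ^ 2 := fun p hp =>
    setIntegral_mono_set (hmem p hp) (Filter.Eventually.of_forall fun x => by positivity)
      (LE.le.eventuallyLE hsub)
  have hidx : ({(2 * n, 0), (2 * n, 1), (2 * n + 1, 0), (2 * n + 1, 1)} : Finset (ℕ × ℕ)) ⊆
      idxLe (2 * N) := by
    intro p hp
    simp only [Finset.mem_insert, Finset.mem_singleton] at hp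
    simp only [idxLe, Finset.mem_filter, Finset.mem_product, Finset.mem_range]
    rcases hp with rfl | rfl | rfl | rfl <;> simp <;> omega
  have hsum : (κ ^ (4 * n))⁻¹ * ((∫ x in K, ‖v x‖ ^ 2) + (κ ^ 2)⁻¹ * (∫ x in K, ‖pd2 v x‖ ^ 2) +
        ((κ ^ 2)⁻¹ * (∫ x in K, ‖pd1 v x‖ ^ 2) +
          (κ ^ 4)⁻¹ * ∫ x in K, ‖pd2 (pd1 v) x‖ ^ 2)) ≤ sobNormSq κ (2 * N) Ω u := by
    calc _ = ∑ p ∈ ({(2 * n, 0), (2 * n, 1), (2 * n + 1, 0), (2 * n + 1, 1)} : Finset (ℕ × ℕ)),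
          (κ ^ (2 * (p.1 + p.2)))⁻¹ * ∫ x in K, ‖pdM p.1 p.2 u x‖ ^ 2 := by
          rw [Finset.sum_insert (by simp), Finset.sum_insert (by simp),
            Finset.sum_insert (by simp), Finset.sum_singleton, e12, e1, e2, e0]
          simp only [mul_add, ← mul_assoc, ← mul_inv, ← pow_add]
          ring_nf
      _ ≤ ∑ p ∈ ({(2 * n, 0), (2 * n, 1), (2 * n + 1, 0), (2 * n + 1, 1)} : Finset (ℕ × ℕ)),
          (κ ^ (2 * (p.1 + p.2)))⁻¹ * ∫ x in Ω, ‖pdM p.1 p.2 u x‖ ^ 2 :=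
          Finset.sum_le_sum fun p hp =>
            mul_le_mul_of_nonneg_left (hmono p (hidx hp)) (by positivity)
      _ ≤ _ := Finset.sum_le_sum_of_subset_of_nonneg hidx fun p _ _ =>
            mul_nonneg (by positivity) (integral_nonneg fun x => by positivity)
  rw [hsplit] at hmain
  calc (b - a) * (d - c) * ((κ⁻¹) ^ (2 * n) * ‖pdM (2 * n) 0 u (x0, y0)‖) ^ 2
      = (κ ^ (4 * n))⁻¹ * ((b - a) * (d - c) * ‖v (x0, y0)‖ ^ 2) := by
        rw [e0, mul_pow, ← pow_mul, inv_pow, show 2 * n * 2 = 4 * n by ring]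
        ring
    _ ≤ (κ ^ (4 * n))⁻¹ * (4 * M ^ 4 * _) := mul_le_mul_of_nonneg_left hmain (by positivity)
    _ = 4 * M ^ 4 * ((κ ^ (4 * n))⁻¹ * _) := by ring
    _ ≤ _ := mul_le_mul_of_nonneg_left hsum (by positivity)

/-! ### The mesh and the collocation system -/

lemma exists_cell_of_mem_meshNodes {h1 h2 : ℝ} (hh1 : 0 < h1) (hh2 : 0 < h2)
    {cells : Finset (ℤ × ℤ)} {q : ℤ × ℤ} (hq : q ∈ meshNodes cells) :
    ∃ c ∈ cells, nodePt h1 h2 q ∈ cellC h1 h2 c := by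
  simp only [meshNodes, Finset.mem_union, Finset.mem_image] at hq
  rcases hq with ((hq | ⟨c, hc, rfl⟩) | ⟨c, hc, rfl⟩) | ⟨c, hc, rfl⟩
  · exact ⟨q, hq, ⟨⟨le_rfl, by simp only [nodePt]; nlinarith⟩,
      ⟨le_rfl, by simp only [nodePt]; nlinarith⟩⟩⟩
  all_goals
    refine ⟨c, hc, ⟨?_, ?_⟩, ⟨?_, ?_⟩⟩ <;> simp only [nodePt] <;> push_cast <;> nlinarith

lemma cellO_subset_of_isTessellation {h1 h2 : ℝ} {cells : Finset (ℤ × ℤ)} {Ω : Set (ℝ × ℝ)}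
    (hT : IsTessellation h1 h2 cells Ω) {c : ℤ × ℤ} (hc : c ∈ cells) : cellO h1 h2 c ⊆ Ω := by
  rw [hT.2.1]
  refine interior_maximal ?_ (isOpen_Ioo.prod isOpen_Ioo)
  exact (prod_mono Ioo_subset_Icc_self Ioo_subset_Icc_self).trans
    (subset_biUnion_of_mem (u := fun c => cellC h1 h2 c) hc)

lemma norm_collocation_datum_le {κ h1 h2 : ℝ} (hκ : 0 < κ) (hh1 : 0 < h1) (hh2 : 0 < h2)
    {cells : Finset (ℤ × ℤ)} {Ω : Set (ℝ × ℝ)} (hT : IsTessellation h1 h2 cells Ω)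
    {N : ℕ} {u : ℝ × ℝ → ℂ} (hreg : ContDiff ℝ (2 * N : ℕ) u) (hmem : MemSob (2 * N) Ω u)
    {q : ℤ × ℤ} (hq : q ∈ meshNodes cells) {n : ℕ} (hn : n < N) :
    ‖((κ : ℂ)⁻¹) ^ (2 * n) * pdM (2 * n) 0 u (nodePt h1 h2 q)‖ ≤
      (2 * (max h1 h2 / min h1 h2) * max 1 (κ * max h1 h2) ^ 2 / max h1 h2) *
        sobNorm κ (2 * N) Ω u := by
  obtain ⟨c, hc, hqc⟩ := exists_cell_of_mem_meshNodes hh1 hh2 hq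
  set M := max 1 (κ * max h1 h2) with hMdef
  have hM1 : 1 ≤ M := le_max_left _ _
  have hMh1 : κ * h1 ≤ M :=
    (mul_le_mul_of_nonneg_left (le_max_left _ _) hκ.le).trans (le_max_right _ _)
  have hMh2 : κ * h2 ≤ M :=
    (mul_le_mul_of_nonneg_left (le_max_right _ _) hκ.le).trans (le_max_right _ _)
  have hd1 : ((c.1 : ℝ) + 1) * h1 - c.1 * h1 = h1 := by ring
  have hd2 : ((c.2 : ℝ) + 1) * h2 - c.2 * h2 = h2 := by ring
  have key := norm_pdM_even_le_sobNorm (M := M) hreg hmem hn hκ hM1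
    (a := (c.1 : ℝ) * h1) (b := ((c.1 : ℝ) + 1) * h1)
    (c := (c.2 : ℝ) * h2) (d := ((c.2 : ℝ) + 1) * h2) (by linarith) (by linarith)
    (by rw [hd1]; exact hMh1) (by rw [hd2]; exact hMh2) hqc.1 hqc.2
    (cellO_subset_of_isTessellation hT hc)
  rw [hd1, hd2] at key
  have hnorm : ‖((κ : ℂ)⁻¹) ^ (2 * n) * pdM (2 * n) 0 u (nodePt h1 h2 q)‖ =
      (κ⁻¹) ^ (2 * n) * ‖pdM (2 * n) 0 u (nodePt h1 h2 q)‖ := by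
    rw [norm_mul, norm_pow, norm_inv, Complex.norm_real, Real.norm_of_nonneg hκ.le]
  rw [hnorm]
  set B := (κ⁻¹) ^ (2 * n) * ‖pdM (2 * n) 0 u (nodePt h1 h2 q)‖ with hB
  have hB0 : 0 ≤ B := by positivity
  have key' : h1 * h2 * B ^ 2 ≤ 4 * M ^ 4 * sobNormSq κ (2 * N) Ω u := key
  have hS : 0 ≤ sobNormSq κ (2 * N) Ω u := by
    by_contra hneg
    have : 4 * M ^ 4 * sobNormSq κ (2 * N) Ω u < 0 :=
      mul_neg_of_pos_of_neg (by positivity) (not_le.mp hneg)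
    have : 0 ≤ h1 * h2 * B ^ 2 := by positivity
    linarith
  have hmin : 0 < min h1 h2 := lt_min hh1 hh2
  have hconst : 2 * (max h1 h2 / min h1 h2) * M ^ 2 / max h1 h2 = 2 * M ^ 2 / min h1 h2 := by
    have : max h1 h2 ≠ 0 := (lt_max_of_lt_left hh1).ne'
    field_simp
  rw [hconst, sobNorm]
  refine abs_le_of_sq_le_sq' ?_ (by positivity) |>.2
  rw [mul_pow (2 * M ^ 2 / min h1 h2), Real.sq_sqrt hS, div_pow, div_mul_eq_mul_div, le_div_iff₀ (by positivity)]
  have hmm : min h1 h2 ^ 2 ≤ h1 * h2 := by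
    rw [sq]
    exact mul_le_mul (min_le_left _ _) (min_le_right _ _) hmin.le hh1.le
  calc B ^ 2 * min h1 h2 ^ 2 ≤ B ^ 2 * (h1 * h2) := by gcongr
    _ = h1 * h2 * B ^ 2 := by ring
    _ ≤ _ := key'
    _ = _ := by ring

lemma collocationSystem_iff {κ h1 h2 : ℝ} (hκ : 0 < κ) (hh1 : 0 < h1) (hh2 : 0 < h2)
    {cells : Finset (ℤ × ℤ)} (hA2 : A2cond κ h1 h2) {N : ℕ} (hN : 1 ≤ N)
    {u : ℝ × ℝ → ℂ} {β : {p : ℤ × ℤ // p ∈ meshNodes cells} × Fin N → ℂ} :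
    CollocationSystem κ h1 h2 cells N u β ↔
      ∀ q : {p : ℤ × ℤ // p ∈ meshNodes cells}, ∀ n < N,
        ∑ m : Fin N, (-1 : ℂ) ^ (m : ℕ) * β (q, m) *
          (-(((((2 * ((m : ℕ) : ℝ) + 1) * π / (2 * (κ * h1))) ^ 2 : ℝ)) : ℂ)) ^ n =
        ((κ : ℂ)⁻¹) ^ (2 * n) * pdM (2 * n) 0 u (nodePt h1 h2 q.1) := by
  have hlhs : ∀ (q : {p : ℤ × ℤ // p ∈ meshNodes cells}) (n : ℕ),
      (∑ p ∈ (meshNodes cells).attach, ∑ m : Fin N,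
        β (p, m) * (((κ : ℂ)⁻¹) ^ (2 * n) *
          pdM (2 * n) 0 (psiNode κ h1 h2 p.1 ((m : ℕ) + 1)) (nodePt h1 h2 q.1))) =
      ∑ m : Fin N, (-1 : ℂ) ^ (m : ℕ) * β (q, m) *
          (-(((((2 * ((m : ℕ) : ℝ) + 1) * π / (2 * (κ * h1))) ^ 2 : ℝ)) : ℂ)) ^ n := by
    intro q n
    rw [Finset.sum_eq_single_of_mem q (Finset.mem_attach _ _)]
    · refine Finset.sum_congr rfl fun m _ => ?_
      rw [pdM_even_psiNode hκ hh1 hh2 hA2, if_pos rfl, pow_mul, mul_left_comm (_ ^ n), ← mul_pow]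
      have : ((κ : ℂ)⁻¹) ^ 2 * (-(((2 * ((m : ℕ) : ℝ) + 1) * π / (2 * h1) : ℝ) : ℂ) ^ 2) =
          -(((((2 * ((m : ℕ) : ℝ) + 1) * π / (2 * (κ * h1))) ^ 2 : ℝ)) : ℂ) := by
        push_cast
        field_simp
      rw [this]
      ring
    · intro p _ hpq
      refine Finset.sum_eq_zero fun m _ => ?_
      rw [pdM_even_psiNode hκ hh1 hh2 hA2, if_neg fun h => hpq (Subtype.ext h), mul_zero, mul_zero]
  constructor
  · intro h q n hn
    rw [← hlhs]
    exact h n (by omega) q.1 q.2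
  · intro h n hn q hq
    exact (hlhs ⟨q, hq⟩ n).trans (h ⟨q, hq⟩ n (by omega))

lemma injective_odd_freq_sq {t : ℝ} (ht : 0 < t) :
    Function.Injective fun j : ℕ => ((2 * (j : ℝ) + 1) * π / (2 * t)) ^ 2 := by
  refine StrictMono.injective fun i j hij => ?_
  have hij' : (i : ℝ) < j := by exact_mod_cast hij
  have hπ := Real.pi_pos
  refine pow_lt_pow_left₀ ?_ (by positivity) two_ne_zero
  gcongr

lemma collocation_prod_le_chiN {κ h1 h2 : ℝ} (hκ : 0 < κ) (hh1 : 0 < h1) (hh2 : 0 < h2)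
    {m N : ℕ} (hm : m < N) :
    ∏ j ∈ (Finset.range N).erase m, (1 + ((2 * (j : ℝ) + 1) * π / (2 * (κ * h1))) ^ 2) /
        |((2 * (j : ℝ) + 1) * π / (2 * (κ * h1))) ^ 2 -
          ((2 * (m : ℝ) + 1) * π / (2 * (κ * h1))) ^ 2| ≤
      chiN (max h1 h2 / min h1 h2) (κ * max h1 h2) N := by
  have hh : κ * h1 ≤ κ * max h1 h2 := mul_le_mul_of_nonneg_left (le_max_left _ _) hκ.le
  have ht : 0 < κ * h1 := mul_pos hκ hh1
  refine (node_prod_bound ht (le_max_left 1 _) (hh.trans (le_max_right _ _)) hm).trans ?_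
  refine min_le_min ?_ le_rfl
  have hmin : 0 < min h1 h2 := lt_min hh1 hh2
  have hmax : 0 < max h1 h2 := lt_max_of_lt_left hh1
  have hcosh : Real.cosh (κ * h1) ≤ Real.exp (κ * max h1 h2) := by
    rw [Real.cosh_eq]
    have e1 : Real.exp (κ * h1) ≤ Real.exp (κ * max h1 h2) := Real.exp_le_exp.mpr hh
    have e2 : Real.exp (-(κ * h1)) ≤ Real.exp (κ * max h1 h2) :=
      Real.exp_le_exp.mpr (by linarith)
    linarith
  rw [show max h1 h2 / min h1 h2 * Real.exp (κ * max h1 h2) / (κ * max h1 h2) =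
    Real.exp (κ * max h1 h2) / (κ * min h1 h2) by field_simp]
  exact div_le_div₀ (Real.exp_pos _).le hcosh (by positivity)
    (mul_le_mul_of_nonneg_left (min_le_left _ _) hκ.le)

/-- A uniform bound on the data of the collocation system bounds its solutions. -/
lemma norm_collocation_solution_le {t : ℝ} (ht : 0 < t) {N : ℕ} {x : Fin N → ℂ} {b : ℕ → ℂ}
    {B : ℝ} (hB : ∀ n < N, ‖b n‖ ≤ B)
    (hsys : ∀ n < N, ∑ m : Fin N, (-1 : ℂ) ^ (m : ℕ) * x m *
      (-(((((2 * ((m : ℕ) : ℝ) + 1) * π / (2 * t)) ^ 2 : ℝ)) : ℂ)) ^ n = b n) (m : Fin N) :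
    ‖x m‖ ≤ (∏ j ∈ (Finset.range N).erase m, (1 + ((2 * (j : ℝ) + 1) * π / (2 * t)) ^ 2) /
        |((2 * (j : ℝ) + 1) * π / (2 * t)) ^ 2 -
          ((2 * ((m : ℕ) : ℝ) + 1) * π / (2 * t)) ^ 2|) * B := by
  have h := norm_vandermonde_solution_le m.2
    (w := fun j : ℕ => ((2 * (j : ℝ) + 1) * π / (2 * t)) ^ 2)
    (fun j => sq_nonneg _) (injective_odd_freq_sq ht)
    (g := fun j => if h : j < N then (-1 : ℂ) ^ j * x ⟨j, h⟩ else 0) hB (fun n hn => by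
      rw [← hsys n hn, Finset.sum_range]
      exact Finset.sum_congr rfl fun j _ => by simp)
  simpa using h

/-- Proposition 4.5, nodal collocation: under Assumption A2, for every
`u ∈ H^{2N}_κ(Ω)` the nodal collocation system has a unique solution `β`, which satisfies
`‖β‖_∞ ≤ (2ρ max(1,κh)²/h) χ_N ‖u‖_{H^{2N}_κ(Ω)}`. -/
theorem nodal_collocation (κ h1 h2 : ℝ) (hκ : 0 < κ) (hh1 : 0 < h1) (hh2 : 0 < h2)
    (cells : Finset (ℤ × ℤ)) (Ω : Set (ℝ × ℝ)) (hT : IsTessellation h1 h2 cells Ω)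
    (hA2 : A2cond κ h1 h2) (N : ℕ) (hN : 1 ≤ N)
    (u : ℝ × ℝ → ℂ) (hreg : ContDiff ℝ (2 * N : ℕ) u) (hmem : MemSob (2 * N) Ω u) :
    (∃! β : {p : ℤ × ℤ // p ∈ meshNodes cells} × Fin N → ℂ,
        CollocationSystem κ h1 h2 cells N u β) ∧
    ∀ β : {p : ℤ × ℤ // p ∈ meshNodes cells} × Fin N → ℂ,
      CollocationSystem κ h1 h2 cells N u β →
      ∀ i, ‖β i‖ ≤
        (2 * (max h1 h2 / min h1 h2) * max 1 (κ * max h1 h2) ^ 2 / max h1 h2) *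
          chiN (max h1 h2 / min h1 h2) (κ * max h1 h2) N *
          sobNorm κ (2 * N) Ω u := by
  have ht : 0 < κ * h1 := mul_pos hκ hh1
  have hiff := fun β => collocationSystem_iff hκ hh1 hh2 (cells := cells) hA2 hN (u := u) (β := β)
  refine ⟨?_, ?_⟩
  · choose g hg using fun q : {p : ℤ × ℤ // p ∈ meshNodes cells} =>
      exists_vandermonde_solution N (injective_odd_freq_sq ht)
        (fun n => ((κ : ℂ)⁻¹) ^ (2 * n) * pdM (2 * n) 0 u (nodePt h1 h2 q.1))
    have hsol : CollocationSystem κ h1 h2 cells N u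
        fun i => (-1 : ℂ) ^ (i.2 : ℕ) * g i.1 i.2 := by
      refine (hiff _).mpr fun q n hn => ?_
      rw [← hg q n hn, Finset.sum_range]
      refine Finset.sum_congr rfl fun m _ => ?_
      rw [← mul_assoc, ← mul_pow, neg_one_mul, neg_neg, one_pow, one_mul]
    refine ⟨_, hsol, fun β hβ => ?_⟩
    funext ⟨q, m⟩
    have hz := norm_collocation_solution_le ht (B := 0) (b := fun _ => 0)
      (x := fun m => β (q, m) - (-1 : ℂ) ^ (m : ℕ) * g q m) (by simp) (fun n hn => by
        have e1 := (hiff _).mp hβ q n hn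
        have e2 := (hiff _).mp hsol q n hn
        simp only [mul_sub, sub_mul, Finset.sum_sub_distrib]
        rw [e1, sub_eq_zero]
        exact e2.symm) m
    rw [mul_zero] at hz
    exact sub_eq_zero.mp (norm_le_zero_iff.mp hz)
  · rintro β hβ ⟨q, m⟩
    have hB := fun n (hn : n < N) => norm_collocation_datum_le hκ hh1 hh2 hT hreg hmem q.2 hn
    have h := norm_collocation_solution_le ht (x := fun m => β (q, m)) hB ((hiff β).mp hβ q) m
    refine h.trans ?_
    calc _ ≤ chiN (max h1 h2 / min h1 h2) (κ * max h1 h2) N *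
          ((2 * (max h1 h2 / min h1 h2) * max 1 (κ * max h1 h2) ^ 2 / max h1 h2) *
            sobNorm κ (2 * N) Ω u) :=
          mul_le_mul_of_nonneg_right (collocation_prod_le_chiN hκ hh1 hh2 m.2)
            ((norm_nonneg _).trans (hB 0 hN))
      _ = _ := by ring

end
end

section
/- Let κ > 0, let N ≥ 1 be an integer, let K ⊂ ℝ² be an open rectangle, and let u : closure(K) → ℂ be such that u and all its partial derivatives up to order 2N extend continuously to closure(K) and u satisfies Δu + κ²u = 0 on K. Then for every point p ∈ closure(K), the following are equivalent: (i) ∂₁^{2n}u(p) = 0 for all integers 0 ≤ n ≤ N−1; (ii) ∂₂^{2n}u(p) = 0 for all integers 0 ≤ n ≤ N−1. -/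
open Real Set
open scoped Real

noncomputable section

/-- Directional derivative along `v`. -/
def dirDeriv (v : ℝ × ℝ) (f : ℝ × ℝ → ℂ) : ℝ × ℝ → ℂ := fun x => fderiv ℝ f x v

section dirDeriv

variable {K : Set (ℝ × ℝ)} {f g : ℝ × ℝ → ℂ} {v w : ℝ × ℝ}

lemma pd1_eq_dirDeriv {x : ℝ × ℝ} (hf : DifferentiableAt ℝ f x) :
    pd1 f x = dirDeriv (1, 0) f x :=
  (hf.hasFDerivAt.comp_hasDerivAt x.1
    ((hasDerivAt_id x.1).prodMk (hasDerivAt_const x.1 x.2))).deriv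

lemma pd2_eq_dirDeriv {x : ℝ × ℝ} (hf : DifferentiableAt ℝ f x) :
    pd2 f x = dirDeriv (0, 1) f x :=
  (hf.hasFDerivAt.comp_hasDerivAt x.2
    ((hasDerivAt_const x.2 x.1).prodMk (hasDerivAt_id x.2))).deriv

lemma dirDeriv_congr (hK : IsOpen K) (h : EqOn f g K) :
    EqOn (dirDeriv v f) (dirDeriv v g) K := fun x hx => by
  have : f =ᶠ[nhds x] g := h.eventuallyEq_of_mem (hK.mem_nhds hx)
  simp only [dirDeriv, this.fderiv_eq]

lemma iterate_dirDeriv_congr (hK : IsOpen K) (h : EqOn f g K) (k : ℕ) :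
    EqOn ((dirDeriv v)^[k] f) ((dirDeriv v)^[k] g) K := by
  induction k with
  | zero => exact h
  | succ k ih =>
    simp only [Function.iterate_succ_apply']
    exact dirDeriv_congr hK ih

lemma differentiableAt_of_contDiffOn {n : ℕ} (hK : IsOpen K) (hn : 1 ≤ n)
    (hf : ContDiffOn ℝ n f K) {x : ℝ × ℝ} (hx : x ∈ K) : DifferentiableAt ℝ f x :=
  (hf.contDiffAt (hK.mem_nhds hx)).differentiableAt (by exact_mod_cast (by omega : n ≠ 0))

lemma contDiffOn_dirDeriv {m n : ℕ} (hK : IsOpen K) (hmn : m + 1 ≤ n)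
    (hf : ContDiffOn ℝ n f K) : ContDiffOn ℝ m (dirDeriv v f) K :=
  (hf.fderiv_of_isOpen hK (by exact_mod_cast hmn)).clm_apply contDiffOn_const

lemma contDiffOn_iterate_dirDeriv (hK : IsOpen K) (k : ℕ) {m n : ℕ} (hmn : m + k ≤ n)
    (hf : ContDiffOn ℝ n f K) : ContDiffOn ℝ m ((dirDeriv v)^[k] f) K := by
  induction k generalizing m with
  | zero => exact hf.of_le (by exact_mod_cast hmn)
  | succ k ih =>
    rw [Function.iterate_succ_apply']
    exact contDiffOn_dirDeriv hK le_rfl (ih (m := m + 1) (by omega))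

lemma iterate_dirDeriv_neg_sub_mul (hK : IsOpen K) (c : ℂ) (k : ℕ)
    (hf : ContDiffOn ℝ k f K) (hg : ContDiffOn ℝ k g K) :
    EqOn ((dirDeriv v)^[k] (fun x => -f x - c * g x))
      (fun x => -(dirDeriv v)^[k] f x - c * (dirDeriv v)^[k] g x) K := by
  induction k with
  | zero => exact fun x _ => rfl
  | succ k ih =>
    intro x hx
    have hle : ((k : ℕ) : WithTop ℕ∞) ≤ ((k + 1 : ℕ) : WithTop ℕ∞) := by
      exact_mod_cast k.le_succ
    have hfx := differentiableAt_of_contDiffOn hK le_rfl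
      (contDiffOn_iterate_dirDeriv (v := v) hK k (m := 1) (by omega) hf) hx
    have hgx := differentiableAt_of_contDiffOn hK le_rfl
      (contDiffOn_iterate_dirDeriv (v := v) hK k (m := 1) (by omega) hg) hx
    simp only [Function.iterate_succ_apply']
    rw [dirDeriv_congr hK (ih (hf.of_le hle) (hg.of_le hle)) hx]
    have h := (hfx.hasFDerivAt.neg.sub (hgx.hasFDerivAt.const_mul c)).fderiv
    exact congrArg (fun L => L v) h

lemma dirDeriv_comm (hK : IsOpen K) (hf : ContDiffOn ℝ (2 : ℕ) f K) :
    EqOn (dirDeriv v (dirDeriv w f)) (dirDeriv w (dirDeriv v f)) K := by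
  intro x hx
  have hfx := hf.contDiffAt (hK.mem_nhds hx)
  have hd : DifferentiableAt ℝ (fderiv ℝ f) x :=
    (hfx.fderiv_right (m := 1) (by norm_num)).differentiableAt one_ne_zero
  have key (a b : ℝ × ℝ) :
      dirDeriv a (dirDeriv b f) x = fderiv ℝ (fderiv ℝ f) x a b := by
    have h := (hd.hasFDerivAt.clm_apply (hasFDerivAt_const b x)).fderiv
    refine (congrArg (fun L => L a) h).trans ?_
    simp
  rw [key, key]
  exact (hfx.isSymmSndFDerivAt (by simp)) v w

lemma dirDeriv_iterate_comm (hK : IsOpen K) (k : ℕ) (hf : ContDiffOn ℝ (k + 1 : ℕ) f K) :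
    EqOn (dirDeriv v ((dirDeriv w)^[k] f)) ((dirDeriv w)^[k] (dirDeriv v f)) K := by
  induction k with
  | zero => exact fun x _ => rfl
  | succ k ih =>
    simp only [Function.iterate_succ_apply']
    refine (dirDeriv_comm hK (contDiffOn_iterate_dirDeriv hK k (by omega) hf)).trans ?_
    exact dirDeriv_congr hK (ih (hf.of_le (by exact_mod_cast (k + 1).le_succ)))

lemma iterate_two_dirDeriv_comm (hK : IsOpen K) (k : ℕ)
    (hf : ContDiffOn ℝ (k + 2 : ℕ) f K) :
    EqOn ((dirDeriv v)^[2] ((dirDeriv w)^[k] f)) ((dirDeriv w)^[k] ((dirDeriv v)^[2] f)) K :=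
  (dirDeriv_congr hK (dirDeriv_iterate_comm hK k
    (hf.of_le (by exact_mod_cast (k + 1).le_succ)))).trans
    (dirDeriv_iterate_comm hK k (contDiffOn_dirDeriv hK le_rfl hf))

lemma pdM_eq_iterate_dirDeriv (hK : IsOpen K) (i j : ℕ) {n : ℕ} (hij : i + j ≤ n)
    (hf : ContDiffOn ℝ n f K) :
    EqOn (pdM i j f) ((dirDeriv (1, 0))^[i] ((dirDeriv (0, 1))^[j] f)) K := by
  have pd_congr {F H : ℝ × ℝ → ℂ} (h : EqOn F H K)
      (hH : ContDiffOn ℝ (1 : ℕ) H K) :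
      EqOn (pd1 F) (dirDeriv (1, 0) H) K ∧ EqOn (pd2 F) (dirDeriv (0, 1) H) K := by
    have hF {x : ℝ × ℝ} (hx : x ∈ K) : DifferentiableAt ℝ F x :=
      differentiableAt_of_contDiffOn hK le_rfl (hH.congr h) hx
    exact ⟨fun x hx => (pd1_eq_dirDeriv (hF hx)).trans (dirDeriv_congr hK h hx),
      fun x hx => (pd2_eq_dirDeriv (hF hx)).trans (dirDeriv_congr hK h hx)⟩
  induction i with
  | zero =>
    induction j with
    | zero => exact fun x _ => rfl
    | succ j ih =>
      simp only [pdM, Function.iterate_zero, id_eq, Function.iterate_succ_apply'] at ih ⊢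
      exact (pd_congr (ih (by omega))
        (contDiffOn_iterate_dirDeriv hK j (by omega) hf)).2
  | succ i ih =>
    simp only [pdM, Function.iterate_succ_apply'] at ih ⊢
    exact (pd_congr (ih (by omega)) (contDiffOn_iterate_dirDeriv hK i (n := i + 1) (by omega)
      (contDiffOn_iterate_dirDeriv hK j (by omega) hf))).1

/-- Differentiating the Helmholtz equation `∂₁^i ∂₂^j` times. -/
lemma pdM_add_two_of_helmholtz (hK : IsOpen K) (c : ℂ) {n : ℕ} (hf : ContDiffOn ℝ n f K)
    (hHelm : ∀ x ∈ K, pdM 2 0 f x + pdM 0 2 f x + c * f x = 0)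
    (i j : ℕ) (hij : i + j + 2 ≤ n) :
    EqOn (pdM (i + 2) j f) (fun x => -pdM i (j + 2) f x - c * pdM i j f x) K := by
  have hlap : EqOn ((dirDeriv (1, 0))^[2] f)
      (fun x => -(dirDeriv (0, 1))^[2] f x - c * f x) K := by
    intro x hx
    have h := hHelm x hx
    rw [pdM_eq_iterate_dirDeriv hK 2 0 (by omega) hf hx,
      pdM_eq_iterate_dirDeriv hK 0 2 (by omega) hf hx] at h
    simp only [Function.iterate_zero, id_eq] at h
    linear_combination h
  have hj : EqOn ((dirDeriv (1, 0))^[2] ((dirDeriv (0, 1))^[j] f))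
      (fun x => -(dirDeriv (0, 1))^[j + 2] f x - c * (dirDeriv (0, 1))^[j] f x) K := by
    refine (iterate_two_dirDeriv_comm hK j
      (hf.of_le (by exact_mod_cast (by omega : j + 2 ≤ n)))).trans ?_
    refine (iterate_dirDeriv_congr hK hlap j).trans ?_
    simp only [Function.iterate_add_apply]
    exact iterate_dirDeriv_neg_sub_mul hK c j
      (contDiffOn_iterate_dirDeriv hK 2 (by omega) hf)
      (hf.of_le (by exact_mod_cast (by omega : j ≤ n)))
  intro x hx
  simp only [pdM_eq_iterate_dirDeriv hK (i + 2) j (by omega) hf hx,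
    pdM_eq_iterate_dirDeriv hK i (j + 2) (by omega) hf hx,
    pdM_eq_iterate_dirDeriv hK i j (by omega) hf hx]
  rw [Function.iterate_add_apply, iterate_dirDeriv_congr hK hj i hx]
  exact iterate_dirDeriv_neg_sub_mul hK c i
    (contDiffOn_iterate_dirDeriv hK (j + 2) (by omega) hf)
    (contDiffOn_iterate_dirDeriv hK j (by omega) hf) hx

end dirDeriv

/-- Lemma 4.7: for a solution of the homogeneous Helmholtz equation on an
open rectangle `K`, all of whose partial derivatives up to order `2N` extend continuously to
the closure of `K` (the extensions being the given family `G`), at any point `p ∈ closure K`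
the first `N` even `∂₁`-derivatives vanish iff the first `N` even `∂₂`-derivatives vanish. -/
theorem even_derivatives_vanish_iff (κ : ℝ) (hκ : 0 < κ) (N : ℕ) (hN : 1 ≤ N)
    (a b c d : ℝ) (hab : a < b) (hcd : c < d)
    (K : Set (ℝ × ℝ)) (hK : K = Ioo a b ×ˢ Ioo c d)
    (u : ℝ × ℝ → ℂ) (hreg : ContDiffOn ℝ (2 * N : ℕ) u K)
    (G : ℕ → ℕ → (ℝ × ℝ → ℂ))
    (hG : ∀ i j : ℕ, i + j ≤ 2 * N →
      ContinuousOn (G i j) (closure K) ∧ EqOn (G i j) (pdM i j u) K)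
    (hGu : G 0 0 = u)
    (hHelm : ∀ x ∈ K, pdM 2 0 u x + pdM 0 2 u x + (κ : ℂ) ^ 2 * u x = 0) :
    ∀ p ∈ closure K,
      ((∀ n : ℕ, n ≤ N - 1 → G (2 * n) 0 p = 0) ↔
        (∀ n : ℕ, n ≤ N - 1 → G 0 (2 * n) p = 0)) := by
  intro p hp
  have hKo : IsOpen K := hK ▸ isOpen_Ioo.prod isOpen_Ioo
  have recurrence (i j : ℕ) (hij : i + j + 1 ≤ N) :
      G (2 * (i + 1)) (2 * j) p =
        -G (2 * i) (2 * (j + 1)) p - (κ : ℂ) ^ 2 * G (2 * i) (2 * j) p := by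
    obtain ⟨c₁, e₁⟩ := hG (2 * (i + 1)) (2 * j) (by omega)
    obtain ⟨c₂, e₂⟩ := hG (2 * i) (2 * (j + 1)) (by omega)
    obtain ⟨c₃, e₃⟩ := hG (2 * i) (2 * j) (by omega)
    have heq : EqOn (G (2 * (i + 1)) (2 * j))
        (fun x => -G (2 * i) (2 * (j + 1)) x - (κ : ℂ) ^ 2 * G (2 * i) (2 * j) x) K := by
      intro x hx
      simp only [e₁ hx, e₂ hx, e₃ hx]
      exact pdM_add_two_of_helmholtz hKo _ hreg hHelm (2 * i) (2 * j) (by omega) hx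
    exact heq.of_subset_closure c₁ (c₂.neg.sub (continuousOn_const.mul c₃))
      subset_closure subset_rfl hp
  constructor
  · intro h
    have all (j : ℕ) : ∀ i, i + j ≤ N - 1 → G (2 * i) (2 * j) p = 0 := by
      induction j with
      | zero => exact fun i hi => h i hi
      | succ j ih =>
        intro i hi
        have h₁ := recurrence i j (by omega)
        rw [ih (i + 1) (by omega), ih i (by omega)] at h₁
        linear_combination h₁
    exact fun n hn => all n 0 (by omega)
  · intro h
    have all (i : ℕ) : ∀ j, i + j ≤ N - 1 → G (2 * i) (2 * j) p = 0 := by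
      induction i with
      | zero => exact fun j hj => h j (by omega)
      | succ i ih =>
        intro j hj
        rw [recurrence i j (by omega), ih (j + 1) (by omega), ih j (by omega)]
        ring
    exact fun n hn => all n 0 (by omega)

end
end

section
/- Let ρ ≥ 1 with ρ² ∈ ℚ. Then there exists an unbounded set K ⊂ (0,+∞) such that sup over t ∈ K of D̃(ρ,t)/t² is finite, where for t > 0: D̃(ρ,t) := 1 + 1/d̃(ρ,t) + 1/√(d̃₀(ρ,t)), with ν̃_n(t) := (2n−1)π/(2t), d̃(ρ,t) := inf{ |√(1−ν̃_n(t)²) − mπρ/t| : m ∈ ℕ, n ≥ 1, ν̃_n(t) < 1 }, and d̃₀(ρ,t) := inf{ √(ν̃_n(t)² − 1) : n ≥ 1, ν̃_n(t) > 1 }. -/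
open Real Set
open scoped Real ENNReal NNReal

noncomputable section

/-- `ν̃_n(t) = (2n−1)π/(2t)`. -/
def nuT (t : ℝ) (n : ℕ) : ℝ := (2 * (n : ℝ) - 1) * π / (2 * t)

/-- `d̃(ρ,t)`, as an extended nonnegative real (so the infimum over the empty family is `∞`). -/
def dT (ρ t : ℝ) : ℝ≥0∞ :=
  ⨅ (n : ℕ) (_ : 1 ≤ n) (_ : nuT t n < 1) (m : ℕ),
    ENNReal.ofReal |Real.sqrt (1 - nuT t n ^ 2) - m * π * ρ / t|

/-- `d̃₀(t)`, as an extended nonnegative real. -/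
def dT0 (t : ℝ) : ℝ≥0∞ :=
  ⨅ (n : ℕ) (_ : 1 ≤ n) (_ : 1 < nuT t n), ENNReal.ofReal (Real.sqrt (nuT t n ^ 2 - 1))

/-- `D̃(ρ,t) = 1 + 1/d̃(ρ,t) + 1/√(d̃₀(t))` (with the conventions `1/∞ = 0`). -/
def DT (ρ t : ℝ) : ℝ≥0∞ := 1 + 1 / dT ρ t + 1 / (dT0 t ^ (1 / 2 : ℝ))

/-- The resonance quotient is an odd multiple of `c / t ^ 2` when `t ^ 2 = c * (2 * N + 1)`, with
`c = π ^ 2 / (8 * q)` and `ρ ^ 2 = p / q`; hence it cannot be small. -/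
lemma le_abs_resonance {ρ t : ℝ} {p : ℤ} {q N : ℕ} (hq : 0 < q)
    (hρ : ρ ^ 2 = p / q) (ht : 0 < t) (hN : t ^ 2 = π ^ 2 / (8 * q) * (2 * N + 1)) (n m : ℕ) :
    π ^ 2 / (8 * q) / t ^ 2 ≤ |1 - nuT t n ^ 2 - (m * π * ρ / t) ^ 2| := by
  have hq0 : (0 : ℝ) < q := by exact_mod_cast hq
  have hodd : (2 * (N : ℤ) + 1 - 2 * (q * (2 * (n : ℤ) - 1) ^ 2 + 4 * m ^ 2 * p)) ≠ 0 := by omega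
  have hone : (1 : ℝ) ≤ |2 * (N : ℝ) + 1 - 2 * (q * (2 * (n : ℝ) - 1) ^ 2 + 4 * m ^ 2 * p)| := by
    exact_mod_cast Int.one_le_abs hodd
  have hfac : 1 - nuT t n ^ 2 - (m * π * ρ / t) ^ 2 = π ^ 2 / (8 * q) / t ^ 2 *
      (2 * (N : ℝ) + 1 - 2 * (q * (2 * (n : ℝ) - 1) ^ 2 + 4 * m ^ 2 * p)) := by
    have h1 : (1 : ℝ) = π ^ 2 / (8 * q) / t ^ 2 * (2 * N + 1) := by
      rw [div_mul_eq_mul_div, ← hN, div_self (by positivity)]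
    have h2 : (m * π * ρ / t) ^ 2 = m ^ 2 * π ^ 2 * (p / q) / t ^ 2 := by rw [← hρ]; ring
    rw [h2, mul_sub, ← h1, nuT]
    field_simp
    ring
  have hc : 0 < π ^ 2 / (8 * q) / t ^ 2 := by positivity
  rw [hfac, abs_mul, abs_of_pos hc]
  exact le_mul_of_one_le_right hc.le hone

lemma div_three_le_abs_sub {a x y : ℝ} (ha : 0 ≤ a) (ha1 : a ≤ 1) (hx : 0 ≤ x) (hy : y ≤ 1)
    (h : y ≤ |a ^ 2 - x ^ 2|) : y / 3 ≤ |a - x| := by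
  rcases le_total x 2 with hx2 | hx2
  · rw [show a ^ 2 - x ^ 2 = (a - x) * (a + x) by ring, abs_mul,
      abs_of_nonneg (add_nonneg ha hx)] at h
    nlinarith [abs_nonneg (a - x)]
  · rw [abs_sub_comm]
    linarith [le_abs_self (x - a)]

lemma DT_le_of_gap {ρ t y : ℝ} (hρ : 0 ≤ ρ) (ht : 0 < t) (hy : 0 < y) (hy1 : y ≤ 1)
    (h : ∀ n m : ℕ, y ≤ |1 - nuT t n ^ 2 - (m * π * ρ / t) ^ 2|) :
    DT ρ t ≤ ENNReal.ofReal (5 / y) := by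
  have hd : ENNReal.ofReal (y / 3) ≤ dT ρ t := by
    refine le_iInf fun n => le_iInf fun hn => le_iInf fun hlt => le_iInf fun m =>
      ENNReal.ofReal_le_ofReal ?_
    have hn' : (1 : ℝ) ≤ n := by exact_mod_cast hn
    have hν : 0 ≤ nuT t n := div_nonneg (mul_nonneg (by linarith) pi_pos.le) (by linarith)
    refine div_three_le_abs_sub (sqrt_nonneg _) ?_ (by positivity) hy1 ?_
    · exact sqrt_le_one.2 (by nlinarith)
    · rw [sq_sqrt (by nlinarith)]
      exact h n m
  have hd0 : ENNReal.ofReal y ≤ dT0 t := by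
    refine le_iInf fun n => le_iInf fun _ => le_iInf fun hlt => ENNReal.ofReal_le_ofReal ?_
    have hy' : y ≤ nuT t n ^ 2 - 1 := by
      have := h n 0
      rw [abs_of_nonpos (by simp only [Nat.cast_zero, zero_mul, zero_div]; nlinarith)] at this
      simp only [Nat.cast_zero, zero_mul, zero_div] at this
      linarith
    exact le_sqrt_of_sq_le (by nlinarith)
  have hd0' : ENNReal.ofReal y ≤ dT0 t ^ (1 / 2 : ℝ) := by
    refine le_trans ?_ (ENNReal.rpow_le_rpow hd0 (by norm_num))
    rw [ENNReal.ofReal_rpow_of_pos hy]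
    refine ENNReal.ofReal_le_ofReal ?_
    simpa using rpow_le_rpow_of_exponent_ge hy hy1 (by norm_num : (1 / 2 : ℝ) ≤ 1)
  have hinv : (1 : ℝ) ≤ 1 / y := (one_le_div hy).2 hy1
  calc DT ρ t ≤ 1 + 1 / ENNReal.ofReal (y / 3) + 1 / ENNReal.ofReal y := by
        unfold DT
        gcongr
    _ = ENNReal.ofReal (1 + 1 / (y / 3) + 1 / y) := by
        rw [ENNReal.ofReal_add (by positivity) (by positivity),
          ENNReal.ofReal_add (by positivity) (by positivity),
          ENNReal.ofReal_div_of_pos (x := 1) (by positivity : 0 < y / 3),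
          ENNReal.ofReal_div_of_pos hy,
          ENNReal.ofReal_one]
    _ ≤ ENNReal.ofReal (5 / y) := by
        refine ENNReal.ofReal_le_ofReal ?_
        rw [show 1 / (y / 3) = 3 * (1 / y) by field_simp, show 5 / y = 5 * (1 / y) by ring]
        linarith

/-- Lemma 5.3, high-frequency regime: if `ρ ≥ 1` and `ρ² ∈ ℚ`, then there
is an unbounded set `K ⊆ (0,∞)` on which `D̃(ρ,t)/t²` is uniformly bounded. -/
theorem high_frequency_resonance_gap (ρ : ℝ) (hρ : 1 ≤ ρ) (hq : ∃ q : ℚ, ρ ^ 2 = (q : ℝ)) :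
    ∃ K : Set ℝ, K ⊆ Ioi (0 : ℝ) ∧ (∀ b : ℝ, ∃ t ∈ K, b < t) ∧
      ∃ C : ℝ≥0∞, C ≠ ⊤ ∧ ∀ t ∈ K, DT ρ t ≤ C * ENNReal.ofReal (t ^ 2) := by
  obtain ⟨r, hr⟩ := hq
  have hrq : ρ ^ 2 = (r.num : ℝ) / (r.den : ℝ) := by rw [hr, Rat.cast_def]
  set c : ℝ := π ^ 2 / (8 * (r.den : ℝ)) with hc
  have hc0 : 0 < c := by
    have := r.den_pos
    positivity
  refine ⟨{t | 0 < t ∧ ∃ N : ℕ, t ^ 2 = c * (2 * N + 1)}, fun t ht => ht.1, fun b => ?_,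
    ENNReal.ofReal (5 / c), ENNReal.ofReal_ne_top, ?_⟩
  · obtain ⟨N, hN⟩ := exists_nat_gt (b ^ 2 / c)
    have hpos : 0 < c * (2 * (N : ℝ) + 1) := by positivity
    refine ⟨√(c * (2 * N + 1)), ⟨sqrt_pos.2 hpos, N, sq_sqrt hpos.le⟩, lt_sqrt_of_sq_lt ?_⟩
    rw [div_lt_iff₀ hc0] at hN
    nlinarith [(Nat.cast_nonneg N : (0 : ℝ) ≤ N)]
  · rintro t ⟨ht, N, hN⟩
    have hct : c ≤ t ^ 2 := by
      rw [hN]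
      exact le_mul_of_one_le_right hc0.le (by linarith [(Nat.cast_nonneg N : (0 : ℝ) ≤ N)])
    have key := DT_le_of_gap (zero_le_one.trans hρ) ht (by positivity : 0 < c / t ^ 2)
      (div_le_one_of_le₀ hct (sq_nonneg t)) (le_abs_resonance r.den_pos hrq ht hN)
    rwa [div_div_eq_mul_div, mul_div_right_comm, ENNReal.ofReal_mul (by positivity)] at key

end
end
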